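/- For every δ > 0 there exists K₀ > 0 such that for every pair of integers (k₁, k₂) satisfying k₁ ≥ K₀, k₂ ≥ K₀, k₁ ≥ δ·k₂ and k₂ ≥ δ·k₁, there exists a nonnegative integer n with s₂(n) = k₁ and s₃(n) = k₂. -/

import Mathlib

/-- Sum of digits of `n` in base `q`. -/
def digitSum (q n : ℕ) : ℕ := (Nat.digits q n).sum

theorem ds_zero (q : ℕ) : digitSum q 0 = 0 := by simp [digitSum]

theorem ds_step {q : ℕ} (hq : 1 < q) (n : ℕ) : digitSum q n = n % q + digitSum q (n / q) := by
  rcases Nat.eq_zero_or_pos n with h | h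
  · subst h; simp [digitSum]
  · unfold digitSum; rw [Nat.digits_def' hq h]; simp

theorem ds_split {q : ℕ} (hq : 1 < q) (c n : ℕ) :
    digitSum q n = digitSum q (n % q ^ c) + digitSum q (n / q ^ c) := by
  induction c generalizing n with
  | zero => simp [Nat.mod_one, ds_zero]
  | succ c ih =>
    rw [ds_step hq n, ih (n / q), ds_step hq (n % q ^ (c+1))]
    have h1 : n % q ^ (c+1) % q = n % q := Nat.mod_mod_of_dvd n (dvd_pow_self q (by omega))
    have h2 : n % q ^ (c+1) / q = n / q % q ^ c := by
      rw [pow_succ', Nat.mod_mul_right_div_self]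
    have h3 : n / q / q ^ c = n / q ^ (c+1) := by rw [Nat.div_div_eq_div_mul, pow_succ']
    rw [h1, h2, h3]; ring

theorem ds_add_mul {q : ℕ} (hq : 1 < q) (c : ℕ) {r : ℕ} (hr : r < q ^ c) (m : ℕ) :
    digitSum q (r + q ^ c * m) = digitSum q r + digitSum q m := by
  rw [ds_split hq c (r + q ^ c * m)]
  have hp : 0 < q ^ c := by positivity
  rw [Nat.add_mul_mod_self_left, Nat.mod_eq_of_lt hr, Nat.add_mul_div_left _ _ hp,
    Nat.div_eq_of_lt hr, zero_add]

theorem ds_mul_pow {q : ℕ} (hq : 1 < q) (c m : ℕ) : digitSum q (q ^ c * m) = digitSum q m := by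
  have := ds_add_mul hq c (r := 0) (by positivity) m
  simpa [ds_zero] using this

theorem ds_lt {q : ℕ} (hq : 1 < q) {n : ℕ} (h : n < q) : digitSum q n = n := by
  rw [ds_step hq, Nat.mod_eq_of_lt h, Nat.div_eq_of_lt h, ds_zero, add_zero]

theorem ds_le {q : ℕ} (hq : 1 < q) (c : ℕ) {n : ℕ} (h : n < q ^ c) : digitSum q n ≤ c * (q - 1) := by
  induction c generalizing n with
  | zero => simp at h; subst h; simp [ds_zero]
  | succ c ih =>
    rw [ds_step hq]
    have h1 : n / q < q ^ c := Nat.div_lt_of_lt_mul (by rwa [pow_succ'] at h)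
    have h2 := ih h1
    have h3 : n % q < q := Nat.mod_lt _ (by omega)
    have : (c+1) * (q-1) = c * (q-1) + (q-1) := by ring
    omega

def Rect (R i0 i1 j0 j1 : ℕ) : Prop :=
  ∀ i j, i0 ≤ i → i ≤ i1 → j0 ≤ j → j ≤ j1 → ∃ r < R, digitSum 2 r = i ∧ digitSum 3 r = j

theorem gadget_add {R a b g r : ℕ} (ha : R ≤ 2 ^ a) (hb : R ≤ 3 ^ b) (hr : r < R)
    (hg2 : 2 ^ a ∣ g) (hg3 : 3 ^ b ∣ g) :
    digitSum 2 (g + r) = digitSum 2 g + digitSum 2 r ∧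
    digitSum 3 (g + r) = digitSum 3 g + digitSum 3 r := by
  obtain ⟨u, rfl⟩ := hg2
  obtain ⟨v, hv⟩ := hg3
  constructor
  · rw [add_comm, ds_add_mul (by norm_num) a (by omega), ds_mul_pow (by norm_num)]; ring
  · rw [hv, add_comm, ds_add_mul (by norm_num) b (by omega), ds_mul_pow (by norm_num)]; ring

theorem Rect.gadget {R i0 i1 j0 j1 : ℕ} (h : Rect R i0 i1 j0 j1) {a b m R' : ℕ}
    (ha : R ≤ 2 ^ a) (hb : R ≤ 3 ^ b) (hR : 2 ^ a * 3 ^ b * m + R ≤ R') :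
    Rect R' (i0 + digitSum 2 (3 ^ b * m)) (i1 + digitSum 2 (3 ^ b * m))
      (j0 + digitSum 3 (2 ^ a * m)) (j1 + digitSum 3 (2 ^ a * m)) := by
  intro i j h1 h2 h3 h4
  obtain ⟨r, hr, hr1, hr2⟩ := h (i - digitSum 2 (3 ^ b * m)) (j - digitSum 3 (2 ^ a * m))
    (by omega) (by omega) (by omega) (by omega)
  have := gadget_add (g := 2 ^ a * 3 ^ b * m) ha hb hr (Dvd.intro (3^b*m) (by ring))
    (Dvd.intro (2^a*m) (by ring))
  refine ⟨2 ^ a * 3 ^ b * m + r, by omega, ?_, ?_⟩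
  · rw [this.1, mul_assoc, ds_mul_pow (by norm_num), hr1]; omega
  · rw [this.2, show 2 ^ a * 3 ^ b * m = 3 ^ b * (2 ^ a * m) by ring, ds_mul_pow (by norm_num), hr2]
    omega

/-- digit sum of a number with at most eight binary digits -/
def leaf2 (n : ℕ) : ℕ := Nat.sub n (Nat.add (Nat.div n 2) (Nat.add (Nat.div n 4) (Nat.add (Nat.div n 8)
  (Nat.add (Nat.div n 16) (Nat.add (Nat.div n 32) (Nat.add (Nat.div n 64) (Nat.div n 128)))))))

/-- digit sum of a number with at most eight ternary digits -/
def leaf3 (n : ℕ) : ℕ := Nat.sub n (Nat.mul 2 (Nat.add (Nat.div n 3) (Nat.add (Nat.div n 9)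
  (Nat.add (Nat.div n 27) (Nat.add (Nat.div n 81) (Nat.add (Nat.div n 243)
  (Nat.add (Nat.div n 729) (Nat.div n 2187))))))))

theorem leaf2_eq (n : ℕ) (hn : n < 2 ^ 8) : leaf2 n = digitSum 2 n := by
  have h2 : (1:ℕ) < 2 := by norm_num
  have h8 : n / 2 / 2 / 2 / 2 / 2 / 2 / 2 / 2 = 0 := by
    simp only [Nat.div_div_eq_div_mul]
    exact Nat.div_eq_of_lt (by simpa using hn)
  rw [ds_step h2, ds_step h2, ds_step h2, ds_step h2, ds_step h2, ds_step h2, ds_step h2,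
    ds_step h2, h8, ds_zero]
  have e : leaf2 n = n - (n/2+(n/4+(n/8+(n/16+(n/32+(n/64+(n/128))))))) := rfl
  have e2 : n / 4 = n / 2 / 2 := by simp only [Nat.div_div_eq_div_mul]
  have e3 : n / 8 = n / 2 / 2 / 2 := by simp only [Nat.div_div_eq_div_mul]
  have e4 : n / 16 = n / 2 / 2 / 2 / 2 := by simp only [Nat.div_div_eq_div_mul]
  have e5 : n / 32 = n / 2 / 2 / 2 / 2 / 2 := by simp only [Nat.div_div_eq_div_mul]
  have e6 : n / 64 = n / 2 / 2 / 2 / 2 / 2 / 2 := by simp only [Nat.div_div_eq_div_mul]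
  have e7 : n / 128 = n / 2 / 2 / 2 / 2 / 2 / 2 / 2 := by simp only [Nat.div_div_eq_div_mul]
  rw [e, e2, e3, e4, e5, e6, e7]
  have m1 := Nat.div_add_mod (n) 2
  have m2 := Nat.div_add_mod (n / 2) 2
  have m3 := Nat.div_add_mod (n / 2 / 2) 2
  have m4 := Nat.div_add_mod (n / 2 / 2 / 2) 2
  have m5 := Nat.div_add_mod (n / 2 / 2 / 2 / 2) 2
  have m6 := Nat.div_add_mod (n / 2 / 2 / 2 / 2 / 2) 2
  have m7 := Nat.div_add_mod (n / 2 / 2 / 2 / 2 / 2 / 2) 2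
  have m8 := Nat.div_add_mod (n / 2 / 2 / 2 / 2 / 2 / 2 / 2) 2
  rw [h8] at m8
  clear e e2 e3 e4 e5 e6 e7 h8 hn
  generalize n % 2 = d0 at *
  generalize n / 2 = n1 at *
  generalize n1 % 2 = d1 at *
  generalize n1 / 2 = n2 at *
  generalize n2 % 2 = d2 at *
  generalize n2 / 2 = n3 at *
  generalize n3 % 2 = d3 at *
  generalize n3 / 2 = n4 at *
  generalize n4 % 2 = d4 at *
  generalize n4 / 2 = n5 at *
  generalize n5 % 2 = d5 at *
  generalize n5 / 2 = n6 at *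
  generalize n6 % 2 = d6 at *
  generalize n6 / 2 = n7 at *
  generalize n7 % 2 = d7 at *
  omega

theorem leaf3_eq (n : ℕ) (hn : n < 3 ^ 8) : leaf3 n = digitSum 3 n := by
  have h2 : (1:ℕ) < 3 := by norm_num
  have h8 : n / 3 / 3 / 3 / 3 / 3 / 3 / 3 / 3 = 0 := by
    simp only [Nat.div_div_eq_div_mul]
    exact Nat.div_eq_of_lt (by simpa using hn)
  rw [ds_step h2, ds_step h2, ds_step h2, ds_step h2, ds_step h2, ds_step h2, ds_step h2,
    ds_step h2, h8, ds_zero]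
  have e : leaf3 n = n - 2 * (n/3+(n/9+(n/27+(n/81+(n/243+(n/729+(n/2187))))))) := rfl
  have e2 : n / 9 = n / 3 / 3 := by simp only [Nat.div_div_eq_div_mul]
  have e3 : n / 27 = n / 3 / 3 / 3 := by simp only [Nat.div_div_eq_div_mul]
  have e4 : n / 81 = n / 3 / 3 / 3 / 3 := by simp only [Nat.div_div_eq_div_mul]
  have e5 : n / 243 = n / 3 / 3 / 3 / 3 / 3 := by simp only [Nat.div_div_eq_div_mul]
  have e6 : n / 729 = n / 3 / 3 / 3 / 3 / 3 / 3 := by simp only [Nat.div_div_eq_div_mul]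
  have e7 : n / 2187 = n / 3 / 3 / 3 / 3 / 3 / 3 / 3 := by simp only [Nat.div_div_eq_div_mul]
  rw [e, e2, e3, e4, e5, e6, e7]
  have m1 := Nat.div_add_mod (n) 3
  have m2 := Nat.div_add_mod (n / 3) 3
  have m3 := Nat.div_add_mod (n / 3 / 3) 3
  have m4 := Nat.div_add_mod (n / 3 / 3 / 3) 3
  have m5 := Nat.div_add_mod (n / 3 / 3 / 3 / 3) 3
  have m6 := Nat.div_add_mod (n / 3 / 3 / 3 / 3 / 3) 3
  have m7 := Nat.div_add_mod (n / 3 / 3 / 3 / 3 / 3 / 3) 3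
  have m8 := Nat.div_add_mod (n / 3 / 3 / 3 / 3 / 3 / 3 / 3) 3
  rw [h8] at m8
  clear e e2 e3 e4 e5 e6 e7 h8 hn
  generalize n % 3 = d0 at *
  generalize n / 3 = n1 at *
  generalize n1 % 3 = d1 at *
  generalize n1 / 3 = n2 at *
  generalize n2 % 3 = d2 at *
  generalize n2 / 3 = n3 at *
  generalize n3 % 3 = d3 at *
  generalize n3 / 3 = n4 at *
  generalize n4 % 3 = d4 at *
  generalize n4 / 3 = n5 at *
  generalize n5 % 3 = d5 at *
  generalize n5 / 3 = n6 at *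
  generalize n6 % 3 = d6 at *
  generalize n6 / 3 = n7 at *
  generalize n7 % 3 = d7 at *
  omega

/-- fast digit sum of a number with at most `8 * 2 ^ k` digits in base `q` -/
def fds (q : ℕ) (leaf : ℕ → ℕ) : ℕ → ℕ → ℕ
  | 0, n => leaf n
  | k+1, n => Nat.add (fds q leaf k (Nat.div n (Nat.pow q (Nat.pow 2 (Nat.add k 3)))))
      (fds q leaf k (Nat.mod n (Nat.pow q (Nat.pow 2 (Nat.add k 3)))))

theorem fds_eq {q : ℕ} (hq : 1 < q) {leaf : ℕ → ℕ}
    (hl : ∀ n, n < q ^ 8 → leaf n = digitSum q n) (k n : ℕ) (hn : n < q ^ (2 ^ (k+3))) :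
    fds q leaf k n = digitSum q n := by
  induction k generalizing n with
  | zero => exact hl n (by simpa using hn)
  | succ k ih =>
    have h1 : n / q ^ (2 ^ (k+3)) < q ^ (2 ^ (k+3)) := by
      apply Nat.div_lt_of_lt_mul
      rwa [← pow_add, ← two_mul, ← pow_succ', show k + 3 + 1 = k + 1 + 3 by ring]
    have : fds q leaf (k+1) n = fds q leaf k (n / q ^ (2 ^ (k+3))) +
      fds q leaf k (n % q ^ (2 ^ (k+3))) := rfl
    rw [this, ih _ h1, ih _ (Nat.mod_lt _ (by positivity)), ds_split hq (2 ^ (k+3)) n]; ring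

set_option exponentiation.threshold 100000

/-- One gadget `(a, b, j, l, c)` stands for `2 ^ a * 3 ^ b * (5 ^ j * 7 ^ l + c)`. -/
abbrev Gad := ℕ × ℕ × ℕ × ℕ × ℕ

def gadM (g : Gad) : ℕ := Nat.add (Nat.mul (Nat.pow 5 g.2.2.1) (Nat.pow 7 g.2.2.2.1)) g.2.2.2.2

def gad2 (g : Gad) : ℕ := Nat.mul (Nat.pow 3 g.2.1) (gadM g)

def gad3 (g : Gad) : ℕ := Nat.mul (Nat.pow 2 g.1) (gadM g)

def cellOk (d e k R i0 i1 j0 j1 u u' v v' : ℕ) (g : Gad) : Bool :=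
  Nat.ble R (Nat.pow 2 g.1) && Nat.ble R (Nat.pow 3 g.2.1) &&
  Nat.ble (Nat.add (Nat.mul (Nat.pow 2 g.1) (gad2 g)) R) (Nat.pow 2 (Nat.mul 8 k)) &&
  Nat.ble (Nat.succ (gad2 g)) (Nat.pow 2 (Nat.pow 2 (Nat.add d 3))) &&
  Nat.ble (Nat.succ (gad3 g)) (Nat.pow 3 (Nat.pow 2 (Nat.add e 3))) &&
  Nat.ble (Nat.add i0 (fds 2 leaf2 d (gad2 g))) u && Nat.ble u' (Nat.add i1 (fds 2 leaf2 d (gad2 g))) &&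
  Nat.ble (Nat.add j0 (fds 3 leaf3 e (gad3 g))) v && Nat.ble v' (Nat.add j1 (fds 3 leaf3 e (gad3 g)))

theorem cellOk_sound {d e k R i0 i1 j0 j1 u u' v v' : ℕ} {g : Gad}
    (h : Rect R i0 i1 j0 j1) (hc : cellOk d e k R i0 i1 j0 j1 u u' v v' g = true) :
    Rect (2 ^ (8 * k)) u u' v v' := by
  obtain ⟨a, b, j, l, c⟩ := g
  simp only [cellOk, Bool.and_eq_true, Nat.ble_eq] at hc
  obtain ⟨⟨⟨⟨⟨⟨⟨⟨h1, h2⟩, h3⟩, h4⟩, h5⟩, h6⟩, h7⟩, h8⟩, h9⟩ := hc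
  have e2 := fds_eq (by norm_num) leaf2_eq d (gad2 (a, b, j, l, c)) h4
  have e3 := fds_eq (by norm_num) leaf3_eq e (gad3 (a, b, j, l, c)) h5
  rw [e2] at h6 h7
  rw [e3] at h8 h9
  have h3' : 2 ^ a * 3 ^ b * gadM (a, b, j, l, c) + R ≤ 2 ^ (8 * k) := by
    rw [mul_assoc]; exact h3
  have := h.gadget (a := a) (b := b) h1 h2 h3'
  intro x y hx hx' hy hy'
  exact this x y (le_trans h6 hx) (le_trans hx' h7) (le_trans h8 hy) (le_trans hy' h9)

def rowOk (d e k R i0 i1 j0 j1 u u' s J : ℕ) : List Gad → ℕ → Bool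
  | [], v => Nat.ble (Nat.succ J) v
  | g :: t, v => cellOk d e k R i0 i1 j0 j1 u u' v (min (v + s) J) g &&
      rowOk d e k R i0 i1 j0 j1 u u' s J t (Nat.succ (v + s))

theorem rowOk_sound {d e k R i0 i1 j0 j1 u u' s J : ℕ} (h : Rect R i0 i1 j0 j1) (t : List Gad) (v : ℕ)
    (hc : rowOk d e k R i0 i1 j0 j1 u u' s J t v = true) : Rect (2 ^ (8 * k)) u u' v J := by
  induction t generalizing v with
  | nil =>
    simp only [rowOk, Nat.ble_eq] at hc
    intro x y _ _ h1 h2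
    omega
  | cons g t ih =>
    simp only [rowOk, Bool.and_eq_true] at hc
    intro x y hx hx' hy hy'
    by_cases hys : y ≤ v + s
    · exact cellOk_sound h hc.1 x y hx hx' hy (le_min hys hy')
    · exact ih _ hc.2 x y hx hx' (by omega) hy'

def gridOk (d e k R i0 i1 j0 j1 s' I s J v : ℕ) : List (List Gad) → ℕ → Bool
  | [], u => Nat.ble (Nat.succ I) u
  | r :: t, u => rowOk d e k R i0 i1 j0 j1 u (min (u + s') I) s J r v &&
      gridOk d e k R i0 i1 j0 j1 s' I s J v t (Nat.succ (u + s'))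

theorem gridOk_sound {d e k R i0 i1 j0 j1 s' I s J v : ℕ} (h : Rect R i0 i1 j0 j1)
    (t : List (List Gad)) (u : ℕ)
    (hc : gridOk d e k R i0 i1 j0 j1 s' I s J v t u = true) : Rect (2 ^ (8 * k)) u I v J := by
  induction t generalizing u with
  | nil =>
    simp only [gridOk, Nat.ble_eq] at hc
    intro x y h1 h2 _ _
    omega
  | cons g t ih =>
    simp only [gridOk, Bool.and_eq_true] at hc
    intro x y hx hx' hy hy'
    by_cases hys : x ≤ u + s'
    · exact rowOk_sound h g v hc.1 x y hx (le_min hys hx') hy hy'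
    · exact ih _ hc.2 x y (by omega) hx' hy hy'

def baseTable : List (ℕ × ℕ × ℕ) := [(8, 10, 1886), (8, 11, 1375), (8, 12, 1916), (8, 13, 1943), (8, 14, 5750), (9, 10, 2014), (9, 11, 1915), (9, 12, 3806), (9, 13, 3563), (9, 14, 5102), (10, 10, 3966), (10, 11, 2015), (10, 12, 8180), (10, 13, 6047), (10, 14, 15038), (11, 10, 6142), (11, 11, 3967), (11, 12, 4094), (11, 13, 10175), (11, 14, 12284)]

theorem rect_one : Rect (2 ^ 14) 8 11 10 14 := by
  have h : ∀ x ∈ baseTable, x.2.2 < 2 ^ 14 ∧ digitSum 2 x.2.2 = x.1 ∧ digitSum 3 x.2.2 = x.2.1 := by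
    have h' : ∀ x ∈ baseTable, x.2.2 < 2 ^ 14 ∧ fds 2 leaf2 2 x.2.2 = x.1 ∧
        fds 3 leaf3 2 x.2.2 = x.2.1 := by decide +kernel
    intro x hx
    obtain ⟨h1, h2, h3⟩ := h' x hx
    rw [fds_eq (by norm_num) leaf2_eq 2 _ (lt_of_lt_of_le h1 (by norm_num))] at h2
    rw [fds_eq (by norm_num) leaf3_eq 2 _ (lt_of_lt_of_le h1 (by norm_num))] at h3
    exact ⟨h1, h2, h3⟩
  have hc : ∀ i < 12, ∀ j < 15, 8 ≤ i → 10 ≤ j →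
      baseTable.any (fun x => Nat.beq x.1 i && Nat.beq x.2.1 j) = true := by decide +kernel
  intro i j h1 h2 h3 h4
  have := hc i (by omega) j (by omega) h1 h3
  simp only [List.any_eq_true, Bool.and_eq_true] at this
  obtain ⟨x, hx, e1, e2⟩ := this
  obtain ⟨g1, g2, g3⟩ := h x hx
  exact ⟨x.2.2, g1, g2.trans (Nat.eq_of_beq_eq_true e1), g3.trans (Nat.eq_of_beq_eq_true e2)⟩

def grid0 : List (List Gad) := [
  [(45, 32, 17, 9, 110), (53, 28, 19, 7, 464), (31, 14, 18, 18, 823), (61, 27, 6, 19, 815),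
    (59, 24, 21, 10, 515), (62, 19, 9, 22, 146), (51, 12, 30, 9, 168), (62, 9, 35, 5, 662),
    (72, 16, 34, 2, 716)],
  [(32, 28, 30, 4, 888), (21, 13, 34, 6, 654), (49, 30, 12, 17, 650), (55, 27, 23, 8, 132),
    (45, 14, 15, 21, 457), (39, 9, 35, 8, 982), (46, 13, 40, 4, 911), (52, 11, 29, 12, 442),
    (65, 16, 19, 17, 341)],
  [(26, 29, 28, 8, 536), (28, 26, 18, 16, 109), (42, 31, 19, 12, 57), (40, 21, 30, 8, 516),
    (27, 15, 18, 23, 598), (32, 12, 15, 26, 742), (56, 21, 14, 22, 580), (41, 11, 21, 22, 480),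
    (54, 13, 29, 13, 500)],
  [(16, 26, 13, 22, 531), (38, 36, 17, 14, 848), (18, 18, 23, 18, 955), (34, 26, 9, 27, 801),
    (33, 21, 6, 32, 723), (24, 12, 21, 24, 725), (40, 20, 11, 29, 824), (49, 16, 43, 3, 584),
    (45, 9, 31, 16, 238)],
  [(16, 29, 18, 19, 498), (39, 37, 7, 23, 792), (25, 24, 7, 30, 591), (27, 27, 32, 9, 519),
    (41, 28, 14, 23, 863), (24, 17, 39, 10, 923), (33, 23, 11, 31, 509), (45, 20, 39, 7, 329),
    (31, 12, 37, 14, 999)],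
  [(28, 48, 20, 12, 696), (17, 37, 26, 13, 377), (16, 29, 37, 8, 592), (23, 27, 42, 3, 614),
    (14, 18, 46, 5, 132), (20, 17, 4, 41, 25), (14, 13, 29, 23, 174), (31, 15, 25, 24, 540),
    (18, 9, 12, 39, 489)],
  [(28, 46, 34, 1, 432), (27, 44, 26, 10, 137), (15, 32, 26, 17, 939), (14, 24, 47, 2, 43),
    (15, 24, 11, 34, 760), (30, 29, 41, 7, 40), (28, 21, 44, 7, 948), (19, 11, 49, 8, 108),
    (15, 9, 19, 35, 685)]]

theorem rect_eight : Rect (2 ^ (8 * 26)) 64 88 80 112 :=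
  gridOk_sound rect_one grid0 64 (d := 5) (e := 5) (k := 26)
    (s' := 3) (s := 3)
    (by decide +kernel)

def grid1 : List (List Gad) := [
  [(250, 157, 81, 158, 649), (283, 152, 254, 18, 443), (301, 138, 80, 170, 995), (437, 197, 158, 72, 771),
    (506, 215, 49, 152, 239), (572, 230, 76, 121, 672), (534, 181, 255, 1, 280), (616, 206, 25, 177, 226),
    (568, 149, 67, 174, 214), (609, 151, 54, 184, 338)],
  [(456, 312, 77, 88, 445), (327, 205, 119, 114, 283), (476, 273, 151, 49, 623), (429, 217, 33, 178, 880),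
    (407, 177, 69, 171, 655), (489, 203, 218, 33, 98), (444, 149, 289, 5, 72), (513, 166, 259, 20, 666),
    (574, 179, 178, 80, 920), (572, 153, 48, 202, 275)],
  [(344, 267, 111, 100, 439), (413, 285, 164, 46, 771), (304, 189, 200, 70, 590), (282, 150, 8, 251, 484),
    (309, 141, 116, 167, 800), (494, 231, 152, 86, 299), (436, 169, 11, 238, 824), (522, 197, 214, 54, 63),
    (503, 159, 26, 231, 701), (547, 163, 269, 28, 792)],
  [(347, 294, 84, 121, 915), (262, 214, 31, 210, 205), (233, 170, 31, 235, 509), (302, 188, 72, 191, 522),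
    (428, 241, 72, 161, 198), (432, 218, 222, 50, 620), (398, 170, 89, 187, 679), (434, 167, 194, 102, 743),
    (452, 152, 187, 116, 72), (495, 155, 132, 160, 893)],
  [(331, 309, 86, 125, 894), (393, 322, 180, 40, 379), (375, 285, 12, 200, 959), (305, 215, 136, 137, 373),
    (370, 230, 46, 203, 251), (424, 238, 26, 215, 449), (385, 187, 103, 180, 146), (477, 219, 214, 70, 193),
    (449, 176, 49, 231, 109), (454, 154, 82, 216, 921)],
  [(319, 327, 240, 2, 449), (314, 298, 191, 59, 129), (233, 220, 14, 249, 216), (382, 288, 97, 142, 196),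
    (363, 250, 106, 156, 635), (357, 221, 148, 138, 845), (290, 152, 23, 280, 291), (384, 186, 22, 262, 737),
    (378, 156, 261, 81, 916), (464, 186, 161, 147, 838)],
  [(344, 368, 227, 4, 433), (270, 295, 82, 165, 324), (296, 285, 213, 62, 168), (281, 250, 63, 206, 984),
    (246, 202, 73, 225, 754), (290, 204, 103, 199, 550), (287, 176, 203, 132, 356), (375, 205, 102, 199, 821),
    (308, 137, 87, 250, 633), (367, 150, 19, 299, 282)],
  [(220, 315, 250, 29, 533), (285, 330, 107, 139, 759), (285, 304, 232, 50, 164), (332, 307, 58, 192, 729),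
    (237, 222, 96, 209, 966), (260, 210, 127, 190, 632), (227, 163, 33, 294, 759), (223, 135, 391, 14, 423),
    (308, 163, 227, 134, 837), (304, 136, 46, 299, 450)],
  [(311, 397, 234, 10, 16), (261, 340, 111, 144, 190), (238, 299, 250, 52, 169), (277, 298, 66, 205, 916),
    (233, 244, 243, 89, 640), (334, 282, 84, 199, 665), (249, 203, 90, 239, 129), (276, 194, 84, 249, 202),
    (294, 179, 337, 48, 858), (347, 188, 244, 120, 751)],
  [(212, 360, 1, 238, 701), (273, 373, 205, 62, 856), (298, 363, 73, 177, 154), (294, 334, 200, 88, 221),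
    (239, 273, 285, 52, 691), (267, 265, 176, 147, 501), (241, 223, 345, 31, 933), (233, 191, 382, 18, 440),
    (274, 191, 254, 124, 560), (299, 182, 387, 19, 33)],
  [(296, 427, 151, 84, 63), (228, 359, 106, 160, 647), (217, 326, 85, 196, 698), (229, 308, 170, 136, 845),
    (274, 310, 247, 71, 147), (218, 249, 238, 113, 321), (276, 259, 192, 145, 359), (248, 215, 123, 227, 539),
    (281, 210, 223, 147, 996), (247, 164, 258, 144, 106)]]

theorem rect_sixtyFour : Rect (2 ^ (8 * 208)) 507 709 640 896 :=
  gridOk_sound rect_eight grid1 507 (d := 8) (e := 8) (k := 208)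
    (s' := 19) (s := 25)
    (by decide +kernel)

def grid2 : List (List Gad) := [
  [(1841, 1156, 2236, 17, 0), (2982, 1643, 410, 1252, 0), (3369, 1656, 711, 996, 0), (4271, 1992, 1255, 356, 0),
    (4432, 1862, 1536, 197, 0), (4794, 1858, 425, 1118, 0), (4420, 1390, 1227, 719, 0), (4993, 1520, 1604, 334, 0),
    (4805, 1189, 1866, 304, 0)],
  [(3344, 2331, 1365, 202, 0), (2988, 1874, 574, 1114, 0), (3098, 1712, 1761, 224, 0), (4072, 2094, 1372, 330, 0),
    (4100, 1880, 1366, 456, 0), (4512, 1907, 92, 1494, 0), (3854, 1260, 397, 1607, 0), (4531, 1456, 1527, 562, 0),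
    (4243, 1062, 910, 1295, 0)],
  [(1699, 1520, 1416, 746, 0), (2958, 2082, 1466, 387, 0), (2811, 1758, 1464, 572, 0), (2705, 1459, 1043, 1089, 0),
    (3569, 1772, 590, 1287, 0), (3953, 1782, 1642, 411, 0), (3191, 1070, 1554, 886, 0), (4366, 1579, 157, 1754, 0),
    (3945, 1101, 1557, 866, 0)],
  [(2578, 2302, 932, 833, 0), (1747, 1546, 360, 1733, 0), (1840, 1372, 1991, 482, 0), (2140, 1330, 2332, 224, 0),
    (2711, 1458, 899, 1337, 0), (2942, 1371, 351, 1839, 0), (3822, 1695, 315, 1686, 0), (4023, 1589, 2110, 261, 0),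
    (3571, 1092, 1867, 743, 0)],
  [(2657, 2579, 1158, 618, 0), (1667, 1722, 1778, 589, 0), (2768, 2185, 363, 1498, 0), (2624, 1862, 1367, 850, 0),
    (2152, 1332, 2576, 149, 0), (3215, 1771, 1418, 859, 0), (3199, 1529, 528, 1732, 0), (3040, 1196, 588, 1870, 0),
    (3580, 1325, 2528, 193, 0)],
  [(2001, 2392, 1541, 535, 0), (2791, 2658, 624, 1143, 0), (2561, 2281, 2238, 21, 0), (2250, 1853, 2182, 309, 0),
    (1706, 1278, 2628, 265, 0), (2881, 1787, 1371, 1017, 0), (2635, 1400, 2183, 564, 0), (2460, 1057, 1897, 994, 0),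
    (2784, 1050, 1565, 1273, 0)],
  [(2717, 3071, 1425, 376, 0), (2056, 2422, 1625, 577, 0), (2163, 2258, 1396, 859, 0), (2532, 2258, 1970, 384, 0),
    (2685, 2122, 2447, 66, 0), (2075, 1506, 538, 1993, 0), (1925, 1179, 56, 2576, 0), (2785, 1490, 1572, 1147, 0),
    (3093, 1471, 2594, 312, 0)],
  [(2346, 3064, 1154, 732, 0), (1976, 2598, 981, 1138, 0), (2392, 2629, 1450, 733, 0), (2361, 2377, 1438, 885, 0),
    (1924, 1870, 1256, 1322, 0), (2144, 1777, 964, 1616, 0), (2016, 1464, 1671, 1208, 0), (2102, 1286, 2132, 927, 0),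
    (2422, 1275, 32, 2670, 0)],
  [(2190, 3193, 98, 1661, 0), (1945, 2806, 484, 1560, 0), (2112, 2679, 608, 1529, 0), (2499, 2691, 63, 1973, 0),
    (2082, 2197, 2687, 82, 0), (1763, 1763, 1110, 1631, 0), (2001, 1681, 778, 1952, 0), (2027, 1466, 63, 2665, 0),
    (1987, 1228, 2416, 853, 0)],
  [(2348, 3406, 2013, 21, 0), (1821, 2842, 789, 1352, 0), (2141, 2812, 291, 1781, 0), (2052, 2524, 2335, 253, 0),
    (1793, 2128, 2368, 449, 0), (1693, 1833, 995, 1751, 0), (1689, 1598, 2032, 1026, 0), (2127, 1643, 847, 1981, 0),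
    (2176, 1461, 618, 2273, 0)]]

theorem rect_fiveTwelve : Rect (2 ^ (8 * 1664)) 4054 5674 5120 7168 :=
  gridOk_sound rect_sixtyFour grid2 4054 (d := 11) (e := 10) (k := 1664)
    (s' := 179) (s := 231)
    (by decide +kernel)



open Finset in
theorem sum_range_mul' (N q : ℕ) (f : ℕ → ℝ) :
    ∑ u ∈ range (N * q), f u = ∑ u' ∈ range N, ∑ d ∈ range q, f (d + q * u') := by
  induction N with
  | zero => simp
  | succ N ih =>
    rw [Nat.succ_mul, sum_range_add, ih, sum_range_succ]
    congr 1
    exact sum_congr rfl fun d _ => by rw [add_comm, mul_comm]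

/-- mean of a digit -/
noncomputable def sg (q : ℕ) : ℝ := ((q : ℝ) - 1) / 2
/-- variance of a digit -/
noncomputable def vr (q : ℕ) : ℝ := ((q : ℝ) ^ 2 - 1) / 12

theorem sg_pos {q : ℕ} (hq : 1 < q) : 0 < sg q := by
  have : (1:ℝ) < q := by exact_mod_cast hq
  unfold sg; linarith
theorem vr_pos {q : ℕ} (hq : 1 < q) : 0 < vr q := by
  have : (1:ℝ) < q := by exact_mod_cast hq
  unfold vr; nlinarith

open Finset in
theorem digit_mean (q : ℕ) : ∑ d ∈ range q, ((d : ℝ) - sg q) = 0 := by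
  have : ∀ n : ℕ, ∑ d ∈ range n, (d : ℝ) = n * (n - 1) / 2 := by
    intro n
    induction n with
    | zero => simp
    | succ n ih => rw [sum_range_succ, ih]; push_cast; ring
  rw [sum_sub_distrib, this, sum_const, card_range, sg, nsmul_eq_mul]; ring

open Finset in
theorem digit_var (q : ℕ) : ∑ d ∈ range q, ((d : ℝ) - sg q) ^ 2 = q * vr q := by
  have : ∀ (n : ℕ) (s : ℝ), ∑ d ∈ range n, ((d : ℝ) - s) ^ 2 =
      n * (n - 1) * (2 * n - 1) / 6 - s * n * (n - 1) + n * s ^ 2 := by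
    intro n s
    induction n with
    | zero => simp
    | succ n ih => rw [sum_range_succ, ih]; push_cast; ring
  rw [this, sg, vr]; ring

open Finset in
theorem ds_moment {q : ℕ} (hq : 1 < q) (c : ℕ) :
    ∑ u ∈ range (q ^ c), ((digitSum q u : ℝ) - c * sg q) ^ 2 = q ^ c * (c * vr q) := by
  induction c with
  | zero => simp [ds_zero]
  | succ c ih =>
    rw [pow_succ, sum_range_mul']
    have : ∀ u ∈ range (q ^ c), ∑ d ∈ range q,
        ((digitSum q (d + q * u) : ℝ) - (c + 1 : ℕ) * sg q) ^ 2 =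
        q * ((digitSum q u : ℝ) - c * sg q) ^ 2 + q * vr q := by
      intro u _
      have h1 : ∀ d ∈ range q, ((digitSum q (d + q * u) : ℝ) - (c + 1 : ℕ) * sg q) ^ 2 =
          ((digitSum q u : ℝ) - c * sg q) ^ 2 +
          2 * ((digitSum q u : ℝ) - c * sg q) * ((d : ℝ) - sg q) + ((d : ℝ) - sg q) ^ 2 := by
        intro d hd
        have := ds_add_mul hq 1 (r := d) (by simpa using hd) u
        rw [pow_one, ds_lt (n := d) hq (by simpa using hd)] at this
        rw [this]; push_cast; ring
      rw [sum_congr rfl h1, sum_add_distrib, sum_add_distrib, ← mul_sum, digit_mean, digit_var]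
      simp
    rw [sum_congr rfl this, sum_add_distrib, ← mul_sum, ih]
    simp
    ring

open Finset in
theorem sum_fiber_le {M N : ℕ} (φ : ℕ → ℕ) (f : ℕ → ℝ) (hf : ∀ u, 0 ≤ f u)
    (hφ : ∀ m < M, φ m < N) (K : ℝ)
    (hK : ∀ u < N, (#{m ∈ range M | φ m = u} : ℝ) ≤ K) :
    ∑ m ∈ range M, f (φ m) ≤ K * ∑ u ∈ range N, f u := by
  rw [← sum_fiberwise_of_maps_to (t := range N) (g := φ) (by simpa using hφ), mul_sum]
  apply sum_le_sum
  intro u hu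
  rw [sum_congr rfl (g := fun _ => f u) (by intro m hm; rw [(mem_filter.1 hm).2]), sum_const,
    nsmul_eq_mul]
  exact mul_le_mul_of_nonneg_right (hK u (by simpa using hu)) (hf u)

open Finset in
theorem fiber_low {q y w M n c u : ℕ} (hco : Nat.Coprime y q) (hcn : c ≤ n) (hq : 1 < q)
    (hcM : q ^ c ≤ M) :
    (#{m ∈ range M | (w + y * m) % q ^ n % q ^ c = u} : ℝ) ≤ 2 * M / q ^ c := by
  have hp : 0 < q ^ c := by positivity
  have h1 : #{m ∈ range M | (w + y * m) % q ^ n % q ^ c = u} ≤ #(range (M / q ^ c + 1)) := by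
    apply card_le_card_of_injOn (fun m => m / q ^ c)
    · intro m hm
      simp only [coe_filter, Set.mem_ofPred_eq, mem_range] at hm
      simp only [coe_range, Set.mem_Iio]
      exact Nat.lt_succ_of_le (Nat.div_le_div_right hm.1.le)
    · intro m hm m' hm' h
      simp only [coe_filter, Set.mem_ofPred_eq, mem_range] at hm hm'
      simp only at h
      rw [Nat.mod_mod_of_dvd _ (pow_dvd_pow q hcn)] at hm hm'
      have h2 : w + y * m ≡ w + y * m' [MOD q ^ c] := hm.2.trans hm'.2.symm
      have h3 : y * m ≡ y * m' [MOD q ^ c] := Nat.ModEq.add_left_cancel' w h2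
      have h4 : m ≡ m' [MOD q ^ c] :=
        Nat.ModEq.cancel_left_of_coprime (Nat.Coprime.pow_left c hco.symm) h3
      rw [← Nat.div_add_mod m (q ^ c), ← Nat.div_add_mod m' (q ^ c), h, h4]
  rw [card_range] at h1
  have hp' : (0:ℝ) < (q:ℝ) ^ c := by exact_mod_cast hp
  have h2 : ((M / q ^ c : ℕ) : ℝ) ≤ M / q ^ c := by
    have := @Nat.cast_div_le ℝ _ _ _ M (q ^ c)
    simpa using this
  have h3 : (1:ℝ) ≤ M / q ^ c := by
    rw [le_div_iff₀ hp']; simpa using (by exact_mod_cast hcM : ((q ^ c : ℕ) : ℝ) ≤ M)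
  have h4 : (#{m ∈ range M | (w + y * m) % q ^ n % q ^ c = u} : ℝ) ≤ ((M / q ^ c : ℕ) : ℝ) + 1 := by
    exact_mod_cast h1
  calc _ ≤ _ := h4
    _ ≤ (M:ℝ) / q ^ c + M / q ^ c := add_le_add h2 h3
    _ = _ := by ring

theorem close_mod_eq {Q y w M m m' : ℕ} (hy : 0 < y) (hyM : y * M ≤ Q) (hm : m < M) (hm' : m' < M)
    (h1 : (w + y * m) % Q < (w + y * m') % Q + y) (h2 : (w + y * m') % Q < (w + y * m) % Q + y) :
    m = m' := by
  wlog hlt : m < m' generalizing m m'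
  · rcases lt_trichotomy m m' with h | h | h
    · exact absurd h hlt
    · exact h
    · exact (this hm' hm h2 h1 h).symm
  exfalso
  have e1 := Nat.div_add_mod (w + y * m) Q
  have e2 := Nat.div_add_mod (w + y * m') Q
  set x := (w + y * m) % Q
  set x' := (w + y * m') % Q
  set k := (w + y * m) / Q
  set k' := (w + y * m') / Q
  have hk : k ≤ k' := Nat.div_le_div_right (by nlinarith)
  have h3 : y * m + y ≤ y * m' := by nlinarith
  have h4 : y * m' + y ≤ y * M := by nlinarith
  rcases Nat.eq_or_lt_of_le hk with h | h
  · rw [h] at e1; omega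
  · have : Q * k + Q ≤ Q * k' := by nlinarith
    omega

open Finset in
theorem fiber_high {q y w M n c u : ℕ} (hy : 0 < y) (hyM : y * M ≤ q ^ n) (hq : 1 < q)
    (hyc : y ≤ q ^ c) :
    (#{m ∈ range M | (w + y * m) % q ^ n / q ^ c = u} : ℝ) ≤ 2 * q ^ c / y := by
  have hp : 0 < q ^ c := by positivity
  have h1 : #{m ∈ range M | (w + y * m) % q ^ n / q ^ c = u} ≤ #(range (q ^ c / y + 1)) := by
    apply card_le_card_of_injOn (fun m => (w + y * m) % q ^ n % q ^ c / y)
    · intro m hm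
      simp only [coe_range, Set.mem_Iio]
      exact Nat.lt_succ_of_le (Nat.div_le_div_right (Nat.mod_lt _ hp).le)
    · intro m hm m' hm' h
      simp only [coe_filter, Set.mem_ofPred_eq, mem_range] at hm hm'
      simp only at h
      apply close_mod_eq (w := w) hy hyM hm.1 hm'.1
      all_goals
        have a1 := Nat.div_add_mod ((w + y * m) % q ^ n) (q ^ c)
        have a2 := Nat.div_add_mod ((w + y * m') % q ^ n) (q ^ c)
        rw [hm.2] at a1
        rw [hm'.2] at a2
        have b1 := Nat.div_add_mod ((w + y * m) % q ^ n % q ^ c) y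
        have b2 := Nat.div_add_mod ((w + y * m') % q ^ n % q ^ c) y
        have c1 := Nat.mod_lt ((w + y * m) % q ^ n % q ^ c) hy
        have c2 := Nat.mod_lt ((w + y * m') % q ^ n % q ^ c) hy
        rw [h] at b1
        omega
  rw [card_range] at h1
  have hy' : (0:ℝ) < y := by exact_mod_cast hy
  have h2 : ((q ^ c / y : ℕ) : ℝ) ≤ q ^ c / y := by
    have := @Nat.cast_div_le ℝ _ _ _ (q ^ c) y
    simpa using this
  have h3 : (1:ℝ) ≤ q ^ c / y := by
    rw [le_div_iff₀ hy']; simpa using (by exact_mod_cast hyc : (y : ℝ) ≤ ((q ^ c : ℕ) : ℝ))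
  have h4 : (#{m ∈ range M | (w + y * m) % q ^ n / q ^ c = u} : ℝ) ≤ ((q ^ c / y : ℕ) : ℝ) + 1 := by
    exact_mod_cast h1
  calc _ ≤ _ := h4
    _ ≤ (q:ℝ) ^ c / y + q ^ c / y := add_le_add h2 h3
    _ = _ := by ring

open Finset in
/-- Second moment of the digit sum along an arithmetic progression. -/
theorem ap_moment {q y w M n c : ℕ} {F : ℝ} (hq : 1 < q) (hy : 0 < y) (hco : Nat.Coprime y q)
    (hyM : y * M ≤ q ^ n) (hF : (q : ℝ) ^ n ≤ F * (y * M)) (hyc : y ≤ q ^ c) (hcM : q ^ c ≤ M)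
    (hcn : c ≤ n) :
    ∑ m ∈ range M, ((digitSum q ((w + y * m) % q ^ n) : ℝ) - n * sg q) ^ 2 ≤
      M * (4 * vr q * (c + F * (n - c))) := by
  have hv := vr_pos hq
  have hy' : (0:ℝ) < y := by exact_mod_cast hy
  have hqp : (0:ℝ) < q := by exact_mod_cast (by omega : 0 < q)
  have hpn : 0 < q ^ n := by positivity
  have hc : ((n - c : ℕ) : ℝ) = n - c := by push_cast [hcn]; ring
  have hB : ∑ m ∈ range M, ((digitSum q ((w + y * m) % q ^ n % q ^ c) : ℝ) - c * sg q) ^ 2 ≤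
      2 * M * (c * vr q) := by
    have := sum_fiber_le (M := M) (N := q ^ c) (fun m => (w + y * m) % q ^ n % q ^ c)
      (fun u => ((digitSum q u : ℝ) - c * sg q) ^ 2) (fun u => sq_nonneg _)
      (fun m _ => Nat.mod_lt _ (by positivity)) (2 * M / q ^ c)
      (fun u _ => fiber_low hco hcn hq hcM)
    rw [ds_moment hq] at this
    refine this.trans (le_of_eq ?_)
    field_simp
  have hT : ∑ m ∈ range M, ((digitSum q ((w + y * m) % q ^ n / q ^ c) : ℝ) - (n - c) * sg q) ^ 2 ≤
      2 * M * (F * (n - c) * vr q) := by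
    have := sum_fiber_le (M := M) (N := q ^ (n - c)) (fun m => (w + y * m) % q ^ n / q ^ c)
      (fun u => ((digitSum q u : ℝ) - (n - c : ℕ) * sg q) ^ 2) (fun u => sq_nonneg _)
      (fun m _ => Nat.div_lt_of_lt_mul (by
        rw [← pow_add, Nat.add_sub_of_le hcn]; exact Nat.mod_lt _ hpn)) (2 * q ^ c / y)
      (fun u _ => fiber_high hy hyM hq hyc)
    rw [ds_moment hq, hc] at this
    refine this.trans ?_
    have e : (q:ℝ) ^ n = q ^ c * q ^ (n - c) := by rw [← pow_add, Nat.add_sub_of_le hcn]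
    have h0 : 0 ≤ ((n:ℝ) - c) * vr q := mul_nonneg (by rw [← hc]; positivity) hv.le
    calc 2 * (q:ℝ) ^ c / y * (q ^ (n - c) * ((n - c) * vr q)) 
        = 2 / y * q ^ n * ((n - c) * vr q) := by rw [e]; ring
      _ ≤ 2 / y * (F * (y * M)) * ((n - c) * vr q) := by gcongr
      _ = _ := by field_simp
  calc ∑ m ∈ range M, ((digitSum q ((w + y * m) % q ^ n) : ℝ) - n * sg q) ^ 2
      ≤ ∑ m ∈ range M, (2 * ((digitSum q ((w + y * m) % q ^ n % q ^ c) : ℝ) - c * sg q) ^ 2 +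
          2 * ((digitSum q ((w + y * m) % q ^ n / q ^ c) : ℝ) - (n - c) * sg q) ^ 2) := by
        apply sum_le_sum
        intro m _
        rw [ds_split hq c ((w + y * m) % q ^ n)]
        push_cast
        nlinarith [sq_nonneg (((digitSum q ((w + y * m) % q ^ n % q ^ c) : ℝ) - c * sg q) -
          ((digitSum q ((w + y * m) % q ^ n / q ^ c) : ℝ) - (n - c) * sg q))]
    _ ≤ _ := by
        rw [sum_add_distrib, ← mul_sum, ← mul_sum]
        linarith

open Finset in
theorem two_select {M : ℕ} (hM : 0 < M) {a b : ℕ → ℝ} {A B : ℝ} (hA : 0 < A) (hB : 0 < B)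
    (ha : ∀ m, 0 ≤ a m) (hb : ∀ m, 0 ≤ b m)
    (h1 : ∑ m ∈ range M, a m ≤ M * A) (h2 : ∑ m ∈ range M, b m ≤ M * B) :
    ∃ m < M, a m ≤ 2 * A ∧ b m ≤ 2 * B := by
  by_contra! h
  have : ∀ m ∈ range M, 2 < a m / A + b m / B := by
    intro m hm
    by_cases h3 : a m ≤ 2 * A
    · have := h m (by simpa using hm) h3
      have h4 : 2 < b m / B := by rwa [lt_div_iff₀ hB]
      have : 0 ≤ a m / A := div_nonneg (ha m) hA.le
      linarith
    · have h4 : 2 < a m / A := by rw [lt_div_iff₀ hA]; linarith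
      have : 0 ≤ b m / B := div_nonneg (hb m) hB.le
      linarith
  have h5 := sum_lt_sum_of_nonempty (s := range M) (by simpa using hM.ne') this
  rw [sum_add_distrib, ← sum_div, ← sum_div] at h5
  have h6 : (∑ m ∈ range M, a m) / A ≤ M := by rw [div_le_iff₀ hA]; exact h1
  have h7 : (∑ m ∈ range M, b m) / B ≤ M := by rw [div_le_iff₀ hB]; exact h2
  simp at h5
  linarith


theorem ap_pair {p q a b M np nq : ℕ} (w1 w2 : ℕ) {F : ℝ} (hp : 1 < p) (hq : 1 < q)
    (hco : Nat.Coprime p q) (hF1 : 1 ≤ F)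
    (h1 : q ^ b * M ≤ p ^ np) (h1' : (p : ℝ) ^ np ≤ F * (q ^ b * M))
    (h2 : p ^ a * M ≤ q ^ nq) (h2' : (q : ℝ) ^ nq ≤ F * (p ^ a * M))
    (h3 : p * q ^ b ≤ M) (h4 : q * p ^ a ≤ M) :
    ∃ m < M, ((digitSum p ((w1 + q ^ b * m) % p ^ np) : ℝ) - np * sg p) ^ 2 ≤ 8 * vr p * F * np ∧
      ((digitSum q ((w2 + p ^ a * m) % q ^ nq) : ℝ) - nq * sg q) ^ 2 ≤ 8 * vr q * F * nq := by
  have key : ∀ {p q b M np w : ℕ}, 1 < p → 1 < q → Nat.Coprime p q → q ^ b * M ≤ p ^ np →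
      (p : ℝ) ^ np ≤ F * (q ^ b * M) → p * q ^ b ≤ M →
      0 < np ∧ ∑ m ∈ Finset.range M, ((digitSum p ((w + q ^ b * m) % p ^ np) : ℝ) - np * sg p) ^ 2
        ≤ M * (4 * vr p * F * np) := by
    intro p q b M np w hp hq hco h1 h1' h3
    have hy : 0 < q ^ b := by positivity
    have hyc : q ^ b ≤ p ^ (Nat.clog p (q ^ b)) := Nat.le_pow_clog hp _
    have hcM : p ^ (Nat.clog p (q ^ b)) ≤ M := by
      rcases Nat.eq_zero_or_pos (Nat.clog p (q ^ b)) with h | h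
      · rw [h]; simp; nlinarith
      · have : p ^ (Nat.clog p (q ^ b) - 1) < q ^ b := by
          apply Nat.pow_pred_clog_lt_self hp
          by_contra h'
          have : q ^ b = 1 := by omega
          rw [this] at h; simp at h
        calc p ^ (Nat.clog p (q ^ b)) = p * p ^ (Nat.clog p (q ^ b) - 1) := by
              rw [← pow_succ']; congr 1; omega
          _ ≤ p * q ^ b := by gcongr
          _ ≤ M := h3
    have hMn : M ≤ p ^ np := le_trans (by nlinarith) h1
    have hcn : Nat.clog p (q ^ b) ≤ np := (Nat.pow_le_pow_iff_right hp).1 (hcM.trans hMn)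
    have hnp : 0 < np := by
      rcases Nat.eq_zero_or_pos np with h | h
      · rw [h] at hMn; simp at hMn; nlinarith
      · exact h
    refine ⟨hnp, ?_⟩
    have := ap_moment (w := w) (F := F) hp hy (Nat.Coprime.pow_left b hco.symm) h1
      (by push_cast; exact h1') hyc hcM hcn
    refine this.trans ?_
    have hv := vr_pos hp
    have hc : ((Nat.clog p (q ^ b) : ℕ) : ℝ) + F * (np - (Nat.clog p (q ^ b) : ℕ)) ≤ F * np := by
      have : (0:ℝ) ≤ (Nat.clog p (q ^ b) : ℕ) := by positivity
      nlinarith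
    calc (M:ℝ) * (4 * vr p * (((Nat.clog p (q ^ b) : ℕ) : ℝ) + F * (np - (Nat.clog p (q ^ b) : ℕ))))
        ≤ M * (4 * vr p * (F * np)) := by gcongr
      _ = _ := by ring
  obtain ⟨k1, k2⟩ := key (w := w1) hp hq hco h1 h1' h3
  obtain ⟨l1, l2⟩ := key (w := w2) hq hp hco.symm h2 h2' h4
  have hM : 0 < M := lt_of_lt_of_le (by positivity) h3
  have hvp := vr_pos hp
  have hvq := vr_pos hq
  have hk : (0:ℝ) < np := by exact_mod_cast k1
  have hl : (0:ℝ) < nq := by exact_mod_cast l1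
  obtain ⟨m, hm, e1, e2⟩ := two_select hM (A := 4 * vr p * F * np) (B := 4 * vr q * F * nq)
    (by positivity) (by positivity) (fun m => sq_nonneg _) (fun m => sq_nonneg _) k2 l2
  exact ⟨m, hm, by linarith, by linarith⟩

def Box (τ : ℕ) : Prop := ∀ i j : ℕ, 95 * τ ≤ 12 * i → 12 * i ≤ 133 * τ → 10 * τ ≤ j → j ≤ 14 * τ →
  ∃ r < 2 ^ (26 * τ), digitSum 2 r = i ∧ digitSum 3 r = j

set_option exponentiation.threshold 20000 in
theorem box_base : Box 512 := by
  intro i j h1 h2 h3 h4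
  exact rect_fiveTwelve i j (by omega) (by omega) (by omega) (by omega)

theorem box_params {τ n2 n3 : ℕ} (hτ : 400 ≤ τ) (h1 : 107 * τ ≤ n2) (h2 : n2 ≤ 159 * τ)
    (h3 : 68 * τ ≤ n3) (h4 : n3 ≤ 100 * τ) (h5 : 6 * n2 ≤ 950 * τ) :
    ∃ a b M : ℕ, 2 ^ (26 * τ) ≤ 2 ^ a ∧ 2 ^ (26 * τ) ≤ 3 ^ b ∧
      3 ^ b * M ≤ 2 ^ n2 ∧ 2 ^ n2 ≤ 3 * (3 ^ b * M) ∧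
      2 ^ a * M ≤ 3 ^ n3 ∧ 3 ^ n3 ≤ 3 * (2 ^ a * M) ∧ 2 * 3 ^ b ≤ M ∧ 3 * 2 ^ a ≤ M ∧
      2 ^ a * 3 ^ b * M + 2 ^ (26 * τ) ≤ 2 ^ (208 * τ) := by
  have t1 : 2 ^ (107 * τ) ≤ 3 ^ n3 := by
    calc 2 ^ (107 * τ) = (2 ^ 107) ^ τ := by rw [pow_mul]
      _ ≤ (3 ^ 68) ^ τ := Nat.pow_le_pow_left (by norm_num) _
      _ = 3 ^ (68 * τ) := by rw [pow_mul]
      _ ≤ 3 ^ n3 := Nat.pow_le_pow_right (by norm_num) h3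
  have t2 : 3 ^ n3 ≤ 2 ^ (159 * τ) := by
    calc 3 ^ n3 ≤ 3 ^ (100 * τ) := Nat.pow_le_pow_right (by norm_num) h4
      _ = (3 ^ 100) ^ τ := by rw [pow_mul]
      _ ≤ (2 ^ 159) ^ τ := Nat.pow_le_pow_left (by norm_num) _
      _ = 2 ^ (159 * τ) := by rw [pow_mul]
  have t3 : 2 ^ (107 * τ) ≤ 2 ^ n2 := Nat.pow_le_pow_right (by norm_num) h1
  have t4 : 2 ^ n2 ≤ 2 ^ (159 * τ) := Nat.pow_le_pow_right (by norm_num) h2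
  have big : ∀ x : ℕ, x ≤ 2 ^ (26 * τ + 2) * 2 ^ (159 * τ) → x + 2 ^ (26 * τ) ≤ 2 ^ (208 * τ) := by
    intro x hx
    rw [← pow_add] at hx
    have e1 : 2 ^ (26 * τ) ≤ 2 ^ (26 * τ + 2 + 159 * τ) := Nat.pow_le_pow_right (by norm_num) (by omega)
    have e2 : 2 ^ (26 * τ + 2 + 159 * τ + 1) ≤ 2 ^ (208 * τ) :=
      Nat.pow_le_pow_right (by norm_num) (by omega)
    rw [pow_succ] at e2
    omega
  have mbig : ∀ M : ℕ, 2 ^ (107 * τ) ≤ 2 ^ (26 * τ + 2) * (M + 1) → 2 ^ (81 * τ - 3) ≤ M := by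
    intro M hM
    have : 2 ^ (81 * τ - 2) ≤ M + 1 := by
      refine Nat.le_of_mul_le_mul_left (c := 2 ^ (26 * τ + 2)) ?_ (by positivity)
      rw [← pow_add]
      refine le_trans (le_of_eq ?_) hM
      congr 1; omega
    have e : 2 ^ (81 * τ - 2) = 2 * 2 ^ (81 * τ - 3) := by rw [← pow_succ']; congr 1; omega
    have : 0 < 2 ^ (81 * τ - 3) := by positivity
    omega
  -- small `y` from `y * M ≤ 2 ^ (159 τ)`
  have ysm : ∀ y M : ℕ, y * M ≤ 2 ^ (159 * τ) → 2 ^ (81 * τ - 3) ≤ M → 3 * y ≤ M := by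
    intro y M hy hM
    by_contra h
    push Not at h
    have hy2 : 2 ^ (81 * τ - 3) ≤ 4 * y := by omega
    have : 2 ^ (81 * τ - 3) * 2 ^ (81 * τ - 3) ≤ 4 * y * M := Nat.mul_le_mul hy2 hM
    have h6 : 2 ^ (81 * τ - 3) * 2 ^ (81 * τ - 3) ≤ 2 ^ (159 * τ + 2) := by
      calc _ ≤ _ := this
        _ = 4 * (y * M) := by ring
        _ ≤ 4 * 2 ^ (159 * τ) := by gcongr
        _ = _ := by rw [pow_add]; ring
    rw [← pow_add, Nat.pow_le_pow_iff_right (by norm_num)] at h6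
    omega
  rcases le_total (3 ^ n3) (2 ^ n2) with hc | hc
  · -- case 1
    set A := 2 ^ (26 * τ + 2) with hA
    have hA0 : 0 < A := by positivity
    set M := 3 ^ n3 / A with hMdef
    have m1 : A * M ≤ 3 ^ n3 := Nat.mul_div_le _ _
    have m2 : 3 ^ n3 < A * (M + 1) := Nat.lt_mul_div_succ _ hA0
    have m3 : 2 ^ (81 * τ - 3) ≤ M := mbig M (t1.trans m2.le)
    have hM0 : 0 < M := lt_of_lt_of_le (by positivity) m3
    have hMle : M ≤ 2 ^ n2 := le_trans (by nlinarith) (m1.trans hc)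
    set b := Nat.log 3 (2 ^ n2 / M) with hb
    have hdiv : 2 ^ n2 / M ≠ 0 := by
      have := Nat.div_pos hMle hM0
      omega
    have b1 : 3 ^ b ≤ 2 ^ n2 / M := Nat.pow_log_le_self 3 hdiv
    have b2 : 2 ^ n2 / M < 3 ^ (b + 1) := Nat.lt_pow_succ_log_self (by norm_num) _
    have b3 : 3 ^ b * M ≤ 2 ^ n2 := (Nat.le_div_iff_mul_le hM0).1 b1
    have b4 : 2 ^ n2 < 3 ^ (b + 1) * M := (Nat.div_lt_iff_lt_mul hM0).1 b2
    rw [pow_succ] at b4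
    have b5 : A < 3 ^ b * 3 := by
      have : A * M < 3 ^ b * 3 * M := lt_of_le_of_lt (m1.trans hc) b4
      exact Nat.lt_of_mul_lt_mul_right this
    have hA4 : A = 4 * 2 ^ (26 * τ) := by rw [hA, pow_add]; ring
    refine ⟨26 * τ + 2, b, M, Nat.pow_le_pow_right (by norm_num) (by omega), ?_, b3, ?_, m1, ?_,
      ?_, ?_, ?_⟩
    · omega
    · nlinarith
    · nlinarith
    · have := ysm _ _ (b3.trans t4) m3
      omega
    · exact ysm _ _ (m1.trans t2) m3
    · apply big
      calc 2 ^ (26 * τ + 2) * 3 ^ b * M = 2 ^ (26 * τ + 2) * (3 ^ b * M) := by ring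
        _ ≤ _ := Nat.mul_le_mul_left _ (b3.trans t4)
  · set b := Nat.clog 3 (2 ^ (26 * τ)) with hb
    have c1 : 2 ^ (26 * τ) ≤ 3 ^ b := Nat.le_pow_clog (by norm_num) _
    have hgt : 1 < 2 ^ (26 * τ) := Nat.one_lt_two_pow (by omega)
    have c2 : 3 ^ (b - 1) < 2 ^ (26 * τ) := Nat.pow_pred_clog_lt_self (by norm_num) hgt
    have c0 : b ≠ 0 := by
      intro h
      rw [h] at c1; simp at c1; omega
    have c3 : 3 ^ b ≤ 2 ^ (26 * τ + 2) := by
      have : 3 ^ b = 3 * 3 ^ (b - 1) := by rw [← pow_succ']; congr 1; omega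
      rw [this, pow_add]; omega
    set M := 2 ^ n2 / 3 ^ b with hMdef
    have hB0 : 0 < 3 ^ b := by positivity
    have m1 : 3 ^ b * M ≤ 2 ^ n2 := Nat.mul_div_le _ _
    have m2 : 2 ^ n2 < 3 ^ b * (M + 1) := Nat.lt_mul_div_succ _ hB0
    have m3 : 2 ^ (81 * τ - 3) ≤ M := mbig M (t3.trans (m2.le.trans (Nat.mul_le_mul_right _ c3)))
    have hM0 : 0 < M := lt_of_lt_of_le (by positivity) m3
    have hMle : M ≤ 3 ^ n3 := le_trans (by nlinarith) (m1.trans hc)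
    set a := Nat.log 2 (3 ^ n3 / M) with ha
    have hdiv : 3 ^ n3 / M ≠ 0 := by
      have := Nat.div_pos hMle hM0
      omega
    have b1 : 2 ^ a ≤ 3 ^ n3 / M := Nat.pow_log_le_self 2 hdiv
    have b2 : 3 ^ n3 / M < 2 ^ (a + 1) := Nat.lt_pow_succ_log_self (by norm_num) _
    have b3 : 2 ^ a * M ≤ 3 ^ n3 := (Nat.le_div_iff_mul_le hM0).1 b1
    have b4 : 3 ^ n3 < 2 ^ (a + 1) * M := (Nat.div_lt_iff_lt_mul hM0).1 b2
    have b5 : 2 ^ (26 * τ) < 2 ^ (a + 1) := by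
      have : 3 ^ b * M < 2 ^ (a + 1) * M := lt_of_le_of_lt (m1.trans hc) b4
      exact lt_of_le_of_lt c1 (Nat.lt_of_mul_lt_mul_right this)
    rw [Nat.pow_lt_pow_iff_right (by norm_num)] at b5
    rw [pow_succ] at b4
    refine ⟨a, b, M, Nat.pow_le_pow_right (by norm_num) (by omega), c1, m1, ?_, b3, ?_,
      ?_, ?_, ?_⟩
    · nlinarith
    · nlinarith
    · have := ysm _ _ (m1.trans t4) m3
      omega
    · exact ysm _ _ (b3.trans t2) m3
    · apply big
      calc 2 ^ a * 3 ^ b * M = 3 ^ b * (2 ^ a * M) := by ring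
        _ ≤ 2 ^ (26 * τ + 2) * 2 ^ (159 * τ) := Nat.mul_le_mul c3 (b3.trans t2)

theorem box_step {τ : ℕ} (hτ : 400 ≤ τ) (h : Box τ) : Box (8 * τ) := by
  intro k1 k2 g1 g2 g3 g4
  obtain ⟨n2, hn2⟩ : ∃ n2, n2 + 19 * τ = 2 * k1 := ⟨2 * k1 - 19 * τ, by omega⟩
  obtain ⟨n3, hn3⟩ : ∃ n3, n3 + 12 * τ = k2 := ⟨k2 - 12 * τ, by omega⟩
  obtain ⟨a, b, M, ha, hb, h1, h1', h2, h2', h3, h4, hR⟩ := box_params (n2 := n2) (n3 := n3) hτ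
    (by omega) (by omega) (by omega) (by omega) (by omega)
  obtain ⟨m, hm, e2, e3⟩ := ap_pair (p := 2) (q := 3) (F := 3) 0 0 (by norm_num) (by norm_num)
    (by norm_num) (by norm_num) h1 (by exact_mod_cast h1') h2 (by exact_mod_cast h2') h3 h4
  have hm2 : 3 ^ b * m < 2 ^ n2 := lt_of_lt_of_le (Nat.mul_lt_mul_of_pos_left hm (by positivity)) h1
  have hm3 : 2 ^ a * m < 3 ^ n3 := lt_of_lt_of_le (Nat.mul_lt_mul_of_pos_left hm (by positivity)) h2
  rw [zero_add, Nat.mod_eq_of_lt hm2] at e2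
  rw [zero_add, Nat.mod_eq_of_lt hm3] at e3
  set s2 := digitSum 2 (3 ^ b * m) with hs2
  set s3 := digitSum 3 (2 ^ a * m) with hs3
  have f2 : (6 * (n2:ℝ) - 12 * s2) ^ 2 ≤ (19 * τ) ^ 2 := by
    have c1 : (6:ℝ) * n2 ≤ 950 * τ := by exact_mod_cast (by omega : 6 * n2 ≤ 950 * τ)
    have c2 : (400:ℝ) ≤ τ := by exact_mod_cast hτ
    norm_num [sg, vr] at e2
    nlinarith
  have f3 : ((n3:ℝ) - s3) ^ 2 ≤ (2 * τ) ^ 2 := by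
    have c1 : (n3:ℝ) ≤ 100 * τ := by exact_mod_cast (by omega : n3 ≤ 100 * τ)
    have c2 : (400:ℝ) ≤ τ := by exact_mod_cast hτ
    norm_num [sg, vr] at e3
    nlinarith
  obtain ⟨f2a, f2b⟩ := abs_le_of_sq_le_sq' f2 (by positivity)
  obtain ⟨f3a, f3b⟩ := abs_le_of_sq_le_sq' f3 (by positivity)
  have i1 : 12 * s2 ≤ 6 * n2 + 19 * τ := by
    have : (12:ℝ) * s2 ≤ 6 * n2 + 19 * τ := by linarith
    exact_mod_cast this
  have i2 : 6 * n2 ≤ 12 * s2 + 19 * τ := by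
    have : (6:ℝ) * n2 ≤ 12 * s2 + 19 * τ := by linarith
    exact_mod_cast this
  have i3 : s3 ≤ n3 + 2 * τ := by
    have : (s3:ℝ) ≤ n3 + 2 * τ := by linarith
    exact_mod_cast this
  have i4 : n3 ≤ s3 + 2 * τ := by
    have : (n3:ℝ) ≤ s3 + 2 * τ := by linarith
    exact_mod_cast this
  obtain ⟨r, hr, r1, r2⟩ := h (k1 - s2) (k2 - s3) (by omega) (by omega) (by omega) (by omega)
  obtain ⟨q1, q2⟩ := gadget_add (g := 2 ^ a * 3 ^ b * m) (a := a) (b := b)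
    (R := 2 ^ (26 * τ)) ha hb hr (Dvd.intro (3^b*m) (by ring)) (Dvd.intro (2^a*m) (by ring))
  refine ⟨2 ^ a * 3 ^ b * m + r, ?_, ?_, ?_⟩
  · have : 2 ^ a * 3 ^ b * m ≤ 2 ^ a * 3 ^ b * M := Nat.mul_le_mul_left _ hm.le
    rw [show 26 * (8 * τ) = 208 * τ by ring]
    omega
  · rw [q1, mul_assoc, ds_mul_pow (by norm_num), r1, ← hs2]; omega
  · rw [q2, show 2 ^ a * 3 ^ b * m = 3 ^ b * (2 ^ a * m) by ring, ds_mul_pow (by norm_num), r2, ← hs3]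
    omega

theorem box_all (i : ℕ) : Box (512 * 8 ^ i) := by
  induction i with
  | zero => simpa using box_base
  | succ i ih =>
    have := box_step (by have := Nat.one_le_pow i 8 (by norm_num); omega) ih
    rwa [show 512 * 8 ^ (i+1) = 8 * (512 * 8 ^ i) by ring]


/-- every point of the circle is followed within `ε` by some multiple `r β`, `r < N` -/
def Dn (β : ℝ) (N : ℕ) (ε : ℝ) : Prop := ∀ x : ℝ, ∃ r < N, Int.fract (r * β - x) < ε

theorem Dn_of {β δ ε : ℝ} {t : ℕ} (z : ℤ) (hδ : 0 < δ) (hδε : δ ≤ ε)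
    (h : (t : ℝ) * β = z + δ ∨ (t : ℝ) * β = z - δ) (ht : 1 ≤ t) : Dn β (t * (⌈1 / δ⌉₊ + 1)) ε := by
  intro x
  have small : ∀ i : ℕ, (i : ℝ) ≤ ⌈1 / δ⌉₊ → t * i < t * (⌈1 / δ⌉₊ + 1) := by
    intro i hi
    have : i ≤ ⌈1 / δ⌉₊ := by exact_mod_cast hi
    exact Nat.mul_lt_mul_of_pos_left (by omega) (by omega)
  have frac : ∀ (y : ℝ) (k : ℤ) (w : ℝ), y = k + w → 0 ≤ w → w < 1 → Int.fract y = w := by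
    intro y k w h1 h2 h3
    rw [Int.fract_eq_iff]
    exact ⟨h2, h3, k, by rw [h1]; ring⟩
  have fl : ∀ (y w : ℝ) (k : ℤ), y = k + w → 0 ≤ w → w < δ → Int.fract y < ε := by
    intro y w k h1 h2 h3
    by_cases h4 : w < 1
    · rw [frac y k w h1 h2 h4]; linarith
    · exact lt_of_lt_of_le (Int.fract_lt_one y) (by linarith)
  rcases h with h | h
  · set y := Int.fract x
    have hy0 : 0 ≤ y := Int.fract_nonneg x
    have hy1 : y < 1 := Int.fract_lt_one x
    refine ⟨t * ⌈y / δ⌉₊, small _ ?_, ?_⟩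
    · exact_mod_cast Nat.ceil_mono (by gcongr)
    · have h1 := Nat.le_ceil (y / δ)
      have h2 := Nat.ceil_lt_add_one (show 0 ≤ y / δ by positivity)
      rw [div_le_iff₀ hδ] at h1
      have h3 : (⌈y / δ⌉₊ : ℝ) * δ < y + δ := by
        have := mul_lt_mul_of_pos_right h2 hδ
        rwa [add_mul, div_mul_cancel₀ _ hδ.ne', one_mul] at this
      refine fl _ (⌈y / δ⌉₊ * δ - y) (⌈y / δ⌉₊ * z - ⌊x⌋) ?_ (by linarith) (by linarith)
      have hx : x = ⌊x⌋ + y := (Int.floor_add_fract x).symm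
      push_cast
      rw [show (t : ℝ) * (⌈y / δ⌉₊ : ℝ) * β = ⌈y / δ⌉₊ * (t * β) by ring, h]
      linear_combination -hx
  · set y := Int.fract (-x)
    have hy0 : 0 ≤ y := Int.fract_nonneg _
    have hy1 : y < 1 := Int.fract_lt_one _
    have h0 : 0 ≤ y / δ := by positivity
    refine ⟨t * ⌊y / δ⌋₊, small _ ?_, ?_⟩
    · calc ((⌊y / δ⌋₊ : ℕ) : ℝ) ≤ y / δ := Nat.floor_le h0
        _ ≤ 1 / δ := by gcongr
        _ ≤ _ := Nat.le_ceil _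
    · have h1 := Nat.floor_le h0
      have h2 := Nat.lt_floor_add_one (y / δ)
      rw [le_div_iff₀ hδ] at h1
      rw [div_lt_iff₀ hδ] at h2
      refine fl _ (y - ⌊y / δ⌋₊ * δ) (⌊y / δ⌋₊ * z + ⌊-x⌋) ?_ (by linarith) (by linarith)
      have hx : -x = ⌊-x⌋ + y := (Int.floor_add_fract (-x)).symm
      push_cast
      rw [show (t : ℝ) * (⌊y / δ⌋₊ : ℝ) * β = ⌊y / δ⌋₊ * (t * β) by ring, h]
      linear_combination hx

theorem Dn_mono {β ε : ℝ} {N N' : ℕ} (h : Dn β N ε) (hN : N ≤ N') : Dn β N' ε := by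
  intro x
  obtain ⟨r, hr, h'⟩ := h x
  exact ⟨r, by omega, h'⟩

/-- quantitative density from a lower bound on small multiples -/
theorem Dn_of_good {β η ε : ℝ} {T : ℕ} (hT : 0 < T) (hη : 0 < η) (hε : 1 / (T + 1 : ℝ) ≤ ε)
    (h : ∀ t : ℕ, 1 ≤ t → t ≤ T → ∀ z : ℤ, η ≤ |t * β - z|) :
    Dn β (T * (⌈1 / η⌉₊ + 1)) ε := by
  obtain ⟨t, ht0, htT, ht⟩ := Real.exists_nat_abs_mul_sub_round_le β hT
  have h1 := h t ht0 htT (round ((t:ℝ) * β))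
  set z := round ((t:ℝ) * β)
  have hpos : 0 < |(t:ℝ) * β - z| := lt_of_lt_of_le hη h1
  have := Dn_of (β := β) (δ := |(t:ℝ) * β - z|) (ε := ε) (t := t) z hpos (by linarith)
    (by rcases abs_cases ((t:ℝ) * β - z) with ⟨e, _⟩ | ⟨e, _⟩
        · left; rw [e]; ring
        · right; rw [e]; ring) ht0
  apply Dn_mono this
  apply Nat.mul_le_mul htT
  have : ⌈1 / |(t:ℝ) * β - z|⌉₊ ≤ ⌈1 / η⌉₊ := Nat.ceil_mono (by gcongr)
  omega

theorem Dn_irrational {φ : ℝ} (hφ : Irrational φ) {ε : ℝ} (hε : 0 < ε) : ∃ N, 0 < N ∧ Dn φ N ε := by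
  obtain ⟨T, hT⟩ := exists_nat_one_div_lt hε
  obtain ⟨t, ht0, htT, ht⟩ := Real.exists_nat_abs_mul_sub_round_le φ (n := T + 1) (by omega)
  set z := round ((t:ℝ) * φ)
  have hpos : 0 < |(t:ℝ) * φ - z| := by
    rw [abs_pos]
    intro h0
    have : (t:ℝ) * φ = (z : ℤ) := by linarith
    exact (hφ.natCast_mul (by omega : t ≠ 0)).ne_int z this
  refine ⟨_, ?_, Dn_of (β := φ) (δ := |(t:ℝ) * φ - z|) (ε := ε) (t := t) z hpos ?_
    (by rcases abs_cases ((t:ℝ) * φ - z) with ⟨e, _⟩ | ⟨e, _⟩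
        · left; rw [e]; ring
        · right; rw [e]; ring) ht0⟩
  · positivity
  · refine ht.trans (le_trans ?_ hT.le)
    push_cast
    gcongr
    linarith

open Finset in
/-- counting visits to an arc -/
theorem count_arc {β ε len : ℝ} {N : ℕ} (h : Dn β N ε) (α u : ℝ) (K V : ℕ)
    (hV : (V : ℝ) * (len + ε) ≤ 1) :
    V * #{m ∈ range K | Int.fract (α + β * (m : ℕ) - u) < len} ≤ K + N := by
  rcases Nat.eq_zero_or_pos V with h0 | hVpos
  · simp [h0]
  have hV0 : (0:ℝ) < V := by exact_mod_cast hVpos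
  have hle : len + ε ≤ 1 / V := by rw [le_div_iff₀ hV0]; linarith
  choose r hr hr' using fun v : ℕ => h ((v : ℝ) / V)
  rw [← card_range V, ← card_product, ← card_range (K + N)]
  have slot : ∀ v < V, ∀ m : ℕ, Int.fract (α + β * m - u) < len →
      ⌊V * Int.fract (α + β * ((m + r v : ℕ) : ℝ) - u)⌋ = (v : ℤ) := by
    intro v hv m hm
    have hv' : (v:ℝ) + 1 ≤ V := by exact_mod_cast hv
    set a := Int.fract (α + β * m - u) with ha
    set b := Int.fract ((r v : ℝ) * β - (v : ℝ) / V) with hb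
    have ha0 : 0 ≤ a := Int.fract_nonneg _
    have hb0 : 0 ≤ b := Int.fract_nonneg _
    have hbe : b < ε := hr' v
    have e1 := Int.floor_add_fract (α + β * m - u)
    have e2 := Int.floor_add_fract ((r v : ℝ) * β - (v : ℝ) / V)
    rw [← ha] at e1
    rw [← hb] at e2
    have hab : a + b < 1 / V := by linarith
    have hab' : V * (a + b) < 1 := by
      rw [lt_div_iff₀ hV0] at hab; linarith
    have hvV : V * ((v:ℝ) / V) = v := by field_simp
    have hf : Int.fract (α + β * ((m + r v : ℕ) : ℝ) - u) = v / V + a + b := by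
      rw [Int.fract_eq_iff]
      refine ⟨by positivity, ?_, ⌊α + β * m - u⌋ + ⌊(r v : ℝ) * β - (v : ℝ) / V⌋, ?_⟩
      · have : (v:ℝ) / V ≤ 1 - 1 / V := by
          rw [div_le_iff₀ hV0, sub_mul, div_mul_cancel₀ _ hV0.ne']; linarith
        linarith
      · push_cast
        linear_combination -e1 - e2
    rw [hf, Int.floor_eq_iff]
    push_cast
    constructor <;> nlinarith
  apply card_le_card_of_injOn (fun x => x.2 + r x.1)
  · rintro ⟨v, m⟩ hx
    simp only [coe_product, Set.mem_prod, coe_range, Set.mem_Iio, coe_filter, mem_range,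
      Set.mem_ofPred_eq] at hx ⊢
    have := hr v
    omega
  · rintro ⟨v, m⟩ hx ⟨v', m'⟩ hx' heq
    simp only [coe_product, Set.mem_prod, coe_range, Set.mem_Iio, coe_filter, mem_range,
      Set.mem_ofPred_eq] at hx hx' heq
    have s1 := slot v hx.1 m hx.2.2
    have s2 := slot v' hx'.1 m' hx'.2.2
    rw [heq, s2] at s1
    have : v' = v := by exact_mod_cast s1
    subst this
    simp only [Prod.mk.injEq, true_and]
    omega


open Finset in
theorem arc_count {A B Q D N G : ℕ} {ε : ℝ} (hQ : 0 < Q) (hG : 1 ≤ G)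
    (h : Dn ((B : ℝ) / Q) N ε) (hV : ((G : ℝ) - 1) * (1 / G + ε) ≤ 1) (v : ℕ) :
    (G - 1) * #{m ∈ range D | G * ((A + B * m) % Q) / Q = v} ≤ D + N := by
  have h1 := count_arc h ((A : ℝ) / Q) ((v : ℝ) / G) D (G - 1) (len := 1 / G)
    (by push_cast [Nat.cast_sub hG]; exact hV)
  refine le_trans (Nat.mul_le_mul_left _ (card_le_card ?_)) h1
  intro m hm
  simp only [mem_filter, mem_range] at hm ⊢
  refine ⟨hm.1, ?_⟩
  have hQ0 : (0:ℝ) < Q := by exact_mod_cast hQ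
  have hG0 : (0:ℝ) < G := by exact_mod_cast hG
  set x := A + B * m with hx
  have e1 : (Q * (x / Q) + x % Q : ℕ) = x := Nat.div_add_mod x Q
  have e1' : (Q : ℝ) * (x / Q : ℕ) + (x % Q : ℕ) = A + B * m := by
    have : ((Q * (x / Q) + x % Q : ℕ) : ℝ) = (x : ℕ) := by rw [e1]
    rw [hx] at this ⊢
    push_cast at this ⊢
    linarith
  have e2 : v * Q ≤ G * (x % Q) := by
    rw [← hm.2]; exact Nat.div_mul_le_self _ _
  have e3 : G * (x % Q) < (v + 1) * Q := by
    rw [← hm.2, mul_comm _ Q]; exact Nat.lt_mul_div_succ _ hQ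
  have e2' : (v : ℝ) * Q ≤ G * (x % Q : ℕ) := by exact_mod_cast e2
  have e3' : (G : ℝ) * (x % Q : ℕ) < (v + 1) * Q := by exact_mod_cast e3
  have hf : Int.fract ((A : ℝ) / Q + B / Q * m - v / G) = (x % Q : ℕ) / Q - v / G := by
    rw [Int.fract_eq_iff]
    refine ⟨?_, ?_, (x / Q : ℕ), ?_⟩
    · rw [sub_nonneg, div_le_div_iff₀ hG0 hQ0]; linarith
    · have : ((x % Q : ℕ) : ℝ) < Q := by exact_mod_cast Nat.mod_lt _ hQ
      have h3 : ((x % Q : ℕ) : ℝ) / Q < 1 := by rwa [div_lt_one hQ0]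
      have : (0:ℝ) ≤ v / G := by positivity
      linarith
    · rw [Int.cast_natCast]
      generalize x / Q = y at e1'
      generalize x % Q = r at e1'
      field_simp
      linear_combination (-(G : ℝ)) * e1'
  rw [hf, sub_lt_iff_lt_add, ← add_div, div_lt_div_iff₀ hQ0 hG0]
  linarith

open Finset in
theorem arc_sum {A B Q D N G : ℕ} {ε : ℝ} (hQ : 0 < Q) (hG : 1 ≤ G)
    (h : Dn ((B : ℝ) / Q) N ε) (hV : ((G : ℝ) - 1) * (1 / G + ε) ≤ 1) (w : ℕ → ℕ) :
    (G - 1) * ∑ m ∈ range D, w (G * ((A + B * m) % Q) / Q) ≤ (D + N) * ∑ v ∈ range G, w v := by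
  rw [← sum_fiberwise_of_maps_to (s := range D) (t := range G)
    (g := fun m => G * ((A + B * m) % Q) / Q)]
  · rw [mul_sum, mul_sum]
    apply sum_le_sum
    intro v _
    have : ∑ m ∈ range D with G * ((A + B * m) % Q) / Q = v, w (G * ((A + B * m) % Q) / Q)
        = #{m ∈ range D | G * ((A + B * m) % Q) / Q = v} * w v := by
      rw [← smul_eq_mul, ← sum_const]
      apply sum_congr rfl
      intro m hm
      rw [(mem_filter.1 hm).2]
    rw [this, ← mul_assoc]
    exact Nat.mul_le_mul_right _ (arc_count hQ hG h hV v)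
  · intro m _
    rw [mem_range]
    apply Nat.div_lt_of_lt_mul
    rw [mul_comm]
    exact Nat.mul_lt_mul_of_pos_right (Nat.mod_lt _ hQ) hG

open Finset in
theorem sum_range_div (q H : ℕ) (w : ℕ → ℕ) :
    ∑ v ∈ range (q * H), w (v / H) = H * ∑ d ∈ range q, w d := by
  rcases Nat.eq_zero_or_pos H with h | h
  · subst h; simp
  induction q with
  | zero => simp
  | succ q ih =>
    rw [add_mul, one_mul, sum_range_add, ih, sum_range_succ, mul_add]
    congr 1
    have : ∑ x ∈ range H, w q = H * w q := by simp
    rw [← this]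
    apply sum_congr rfl
    intro x hx
    rw [mem_range] at hx
    congr 1
    rw [mul_comm, Nat.mul_add_div h, Nat.div_eq_of_lt hx, add_zero]

theorem digit_eq {q H i x : ℕ} (hq : 0 < q) (hH : 0 < H) :
    (q * H * (x % q ^ (i + 1)) / q ^ (i + 1)) / H = x / q ^ i % q := by
  rw [Nat.div_div_eq_div_mul]
  have h1 : x / q ^ i % q = x % q ^ (i + 1) / q ^ i := by
    rw [pow_succ, Nat.mod_mul_right_div_self]
  rw [h1, show q * H * (x % q ^ (i + 1)) = (q * H) * (x % q ^ (i + 1)) by ring,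
    show q ^ (i + 1) * H = (q * H) * q ^ i by ring]
  exact Nat.mul_div_mul_left _ _ (by positivity)

open Finset in
theorem ds_window {q : ℕ} (hq : 1 < q) (x t Λ : ℕ) :
    digitSum q (x / q ^ t) = ∑ j ∈ range Λ, (x / q ^ (t + j) % q) + digitSum q (x / q ^ (t + Λ)) := by
  induction Λ with
  | zero => simp
  | succ n ih =>
    rw [ih, sum_range_succ, ds_step hq (x / q ^ (t + n)), Nat.div_div_eq_div_mul, ← pow_succ]
    rw [show t + (n + 1) = t + n + 1 by ring]; ring

theorem ds_sub {q : ℕ} (hq : 1 < q) (a b : ℕ) : digitSum q (a + b) ≤ digitSum q a + digitSum q b := by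
  induction a using Nat.strong_induction_on generalizing b with
  | _ a ih =>
    rcases Nat.eq_zero_or_pos a with h | h
    · subst h; simp [ds_zero]
    rw [ds_step hq (a + b), ds_step hq a, ds_step hq b]
    have h1 := ih (a / q) (Nat.div_lt_self h hq) (b / q)
    have hm : a % q < q := Nat.mod_lt _ (by omega)
    have hm' : b % q < q := Nat.mod_lt _ (by omega)
    rw [Nat.add_mod, Nat.add_div (by omega)]
    split_ifs with hc
    · have h2 : digitSum q (a / q + b / q + 1) ≤ digitSum q (a/q + b/q) + 1 := by
        clear h1
        generalize a / q + b / q = y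
        induction y using Nat.strong_induction_on with
        | _ y ihy =>
          rw [ds_step hq (y + 1), ds_step hq y]
          have hy : y % q < q := Nat.mod_lt _ (by omega)
          rw [Nat.add_mod, Nat.add_div (by omega), Nat.mod_eq_of_lt hq, Nat.div_eq_of_lt hq]
          split_ifs with hc'
          · rcases Nat.eq_zero_or_pos y with h0 | h0
            · subst h0; simp at hc'; omega
            have := ihy (y / q) (Nat.div_lt_self h0 hq)
            have e : y % q + 1 = q := by omega
            rw [e]; simp; omega
          · rw [Nat.mod_eq_of_lt (by omega)]; simp; omega
      have : (a % q + b % q) % q = a % q + b % q - q := by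
        rw [Nat.mod_eq_sub_mod hc, Nat.mod_eq_of_lt (by omega)]
      omega
    · rw [Nat.mod_eq_of_lt (by omega)]; simp; omega


open Finset in
theorem block_pick {q H G D N B A f c Λ : ℕ} {ε : ℝ} (hq : 1 < q) (hGH : G = q * H) (hG : 8 ≤ G)
    (hD : 0 < D) (hN : N * G ≤ D) (hΛ : 0 < Λ) (hΛf : Λ ≤ f)
    (hdn : ∀ j, c ≤ j → j ≤ Λ → Dn ((B : ℝ) / (q ^ (f - j) : ℕ)) N ε) (hc : c ≤ Λ)
    (hV : ((G : ℝ) - 1) * (1 / G + ε) ≤ 1) (w : ℕ → ℕ)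
    (hw : (∑ d ∈ range q, w d) * 2 = q * (q - 1)) :
    ∃ m < D, G * ((A + B * m) % q ^ (f - Λ)) / q ^ (f - Λ) ≠ G - 1 ∧
      (G : ℝ) * ∑ j ∈ Ico c Λ, (w ((A + B * m) / q ^ (f - j - 1) % q) : ℝ)
        ≤ (G * sg q + 5 * q) * Λ := by
  have hH : 0 < H := by
    rcases Nat.eq_zero_or_pos H with h | h
    · subst h; omega
    · exact h
  set R : ℕ → ℕ := fun m => ∑ j ∈ Ico c Λ, w ((A + B * m) / q ^ (f - j - 1) % q) with hR
  set bad : ℕ → ℕ := fun m =>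
    (if G * ((A + B * m) % q ^ (f - Λ)) / q ^ (f - Λ) = G - 1 then 1 else 0) with hbad
  have hwR : (∑ v ∈ range G, w (v / H)) * 2 = G * (q - 1) := by
    rw [hGH, sum_range_div, mul_assoc, hw]; ring
  have sR : (G - 1) * (∑ m ∈ range D, R m) * 2 ≤ (D + N) * (Λ * (G * (q - 1))) := by
    rw [hR, sum_comm, mul_sum, sum_mul]
    calc _ ≤ ∑ j ∈ Ico c Λ, (D + N) * (G * (q - 1)) := by
          apply sum_le_sum
          intro j hj
          rw [mem_Ico] at hj
          have := arc_sum (A := A) (D := D) (by positivity) (by omega) (hdn j hj.1 hj.2.le) hV (fun v => w (v / H))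
          rw [show f - j = f - j - 1 + 1 by omega, hGH] at this
          simp only [digit_eq (show 0 < q by omega) hH] at this
          rw [← hGH] at this
          calc _ ≤ ((D + N) * ∑ v ∈ range G, w (v / H)) * 2 := Nat.mul_le_mul_right _ this
            _ = _ := by rw [mul_assoc, hwR]
      _ = (Λ - c) * ((D + N) * (G * (q - 1))) := by simp
      _ ≤ Λ * ((D + N) * (G * (q - 1))) := Nat.mul_le_mul_right _ (by omega)
      _ = _ := by ring
  have sb : (G - 1) * (∑ m ∈ range D, bad m) ≤ D + N := by
    have := arc_sum (A := A) (D := D) (by positivity) (by omega) (hdn Λ hc le_rfl) hV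
      (fun v => if v = G - 1 then 1 else 0)
    simp only [sum_ite_eq', mem_range] at this
    rw [if_pos (by omega), mul_one] at this
    exact this
  have sR' : ((G:ℝ) - 1) * (∑ m ∈ range D, (R m : ℝ)) ≤ (D + N) * (Λ * (G * sg q)) := by
    have : (((G - 1) * (∑ m ∈ range D, R m) * 2 : ℕ) : ℝ) ≤ ((D + N) * (Λ * (G * (q - 1))) : ℕ) := by
      exact_mod_cast sR
    push_cast [Nat.cast_sub (show 1 ≤ G by omega), Nat.cast_sub (show 1 ≤ q by omega)] at this
    unfold sg
    linarith
  have sb' : ((G:ℝ) - 1) * (∑ m ∈ range D, (bad m : ℝ)) ≤ D + N := by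
    have : (((G - 1) * (∑ m ∈ range D, bad m) : ℕ) : ℝ) ≤ (D + N : ℕ) := by exact_mod_cast sb
    rw [Nat.cast_mul, Nat.cast_sub (show 1 ≤ G by omega)] at this
    push_cast at this ⊢
    exact this
  have hD0 : (0:ℝ) < D := by exact_mod_cast hD
  have hG0 : (8:ℝ) ≤ G := by exact_mod_cast hG
  have hΛ0 : (0:ℝ) < Λ := by exact_mod_cast hΛ
  have hq0 : (2:ℝ) ≤ q := by exact_mod_cast hq
  have hN' : (N : ℝ) * G ≤ D := by exact_mod_cast hN
  have hsg : sg q = ((q:ℝ) - 1) / 2 := rfl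
  obtain ⟨m, hm, hle⟩ : ∃ m ∈ range D, ((G:ℝ) - 1) * G * (R m + q * Λ * bad m)
      ≤ (G + 1) * (Λ * (G * sg q + q)) := by
    apply exists_le_of_sum_le (by simpa using hD.ne')
    rw [← mul_sum, sum_add_distrib, ← mul_sum, sum_const, card_range, nsmul_eq_mul]
    have e1 : ((G:ℝ) - 1) * (∑ m ∈ range D, (R m : ℝ) + q * Λ * ∑ m ∈ range D, (bad m : ℝ))
        ≤ (D + N) * (Λ * (G * sg q + q)) := by
      have := mul_le_mul_of_nonneg_left sb' (show 0 ≤ (q:ℝ) * Λ by positivity)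
      nlinarith
    have e2 := mul_le_mul_of_nonneg_left e1 (show (0:ℝ) ≤ G by linarith)
    have e3 : (0:ℝ) ≤ Λ * (G * sg q + q) := by
      have := sg_pos hq
      positivity
    have e4 : (G:ℝ) * (D + N) ≤ D * (G + 1) := by linarith
    have e5 := mul_le_mul_of_nonneg_right e4 e3
    linarith
  refine ⟨m, mem_range.1 hm, ?_, ?_⟩
  · intro hb
    have hb1 : bad m = 1 := by simp only [hbad]; rw [if_pos hb]
    rw [hb1] at hle
    have hR0 : (0:ℝ) ≤ R m := by positivity
    have h1 : ((G:ℝ) - 1) * G * (q * Λ) ≤ (G + 1) * (Λ * (G * sg q + q)) := by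
      refine le_trans ?_ hle
      have : (0:ℝ) ≤ (G - 1) * G := by nlinarith
      apply mul_le_mul_of_nonneg_left _ this
      push_cast; linarith
    have h2 : ((G:ℝ) - 1) * G * q ≤ (G + 1) * (G * sg q + q) := by
      have : Λ * (((G:ℝ) - 1) * G * q) ≤ Λ * ((G + 1) * (G * sg q + q)) := by linarith
      exact le_of_mul_le_mul_left this hΛ0
    rw [hsg] at h2
    have h3 : 2 * (((G:ℝ) - 1) * G * q) ≤ (G + 1) * (G * q - G + 2 * q) := by nlinarith
    nlinarith [mul_nonneg (show (0:ℝ) ≤ G - 8 by linarith) (show (0:ℝ) ≤ q by linarith),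
      mul_nonneg (mul_nonneg (show (0:ℝ) ≤ G - 8 by linarith) (show (0:ℝ) ≤ q by linarith))
        (show (0:ℝ) ≤ G by linarith)]
  · have hb0 : (0:ℝ) ≤ q * Λ * bad m := by positivity
    have h1 : ((G:ℝ) - 1) * (G * R m) ≤ (G - 1) * ((G * sg q + 5 * q) * Λ) := by
      calc ((G:ℝ) - 1) * (G * R m) = ((G:ℝ) - 1) * G * (R m) := by ring
        _ ≤ ((G:ℝ) - 1) * G * (R m + q * Λ * bad m) := by
            apply mul_le_mul_of_nonneg_left (by linarith) (by nlinarith)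
        _ ≤ (G + 1) * (Λ * (G * sg q + q)) := hle
        _ = Λ * ((G + 1) * (G * sg q + q)) := by ring
        _ ≤ Λ * ((G - 1) * (G * sg q + 5 * q)) := by
            apply mul_le_mul_of_nonneg_left _ hΛ0.le
            rw [hsg]
            nlinarith [mul_nonneg (show (0:ℝ) ≤ G - 8 by linarith) (show (0:ℝ) ≤ q by linarith)]
        _ = _ := by ring
    have h2 := le_of_mul_le_mul_left h1 (by linarith)
    simpa [hR] using h2

open Finset in
theorem ds_window_rev {q : ℕ} (hq : 1 < q) (x f Λ : ℕ) (h : Λ ≤ f) :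
    digitSum q (x / q ^ (f - Λ)) = ∑ j ∈ range Λ, (x / q ^ (f - j - 1) % q) + digitSum q (x / q ^ f) := by
  rw [ds_window hq x (f - Λ) Λ, ← sum_range_reflect, show f - Λ + Λ = f by omega]
  congr 1
  apply sum_congr rfl
  intro j hj
  rw [mem_range] at hj
  rw [show f - Λ + (Λ - 1 - j) = f - j - 1 by omega]

/-- the digits of `A` above position `f` are safe -/
def Safe (q G A f : ℕ) : Prop := G * (A % q ^ f) < (G - 1) * q ^ f

theorem Safe.div_eq {q G A f B : ℕ} (hq : 0 < q) (hG : 0 < G) (h : Safe q G A f) (hB : G * B ≤ q ^ f) :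
    (A + B) / q ^ f = A / q ^ f := by
  unfold Safe at h
  have h1 : G * (A % q ^ f + B) < G * q ^ f := by
    have : G * q ^ f = (G - 1) * q ^ f + q ^ f := by
      obtain ⟨g, rfl⟩ : ∃ g, G = g + 1 := ⟨G - 1, by omega⟩
      simp; ring
    rw [mul_add]; omega
  have h2 := Nat.lt_of_mul_lt_mul_left h1
  conv_lhs => rw [← Nat.div_add_mod A (q ^ f), add_assoc]
  rw [Nat.mul_add_div (by positivity), Nat.div_eq_of_lt h2, add_zero]

open Finset in
theorem good_step {q H G D N B A f c Λ : ℕ} {ε a e0 : ℝ} (hq : 1 < q) (hGH : G = q * H) (hG : 8 ≤ G)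
    (hD : 0 < D) (hN : N * G ≤ D) (hΛ : 0 < Λ) (hΛf : Λ ≤ f)
    (hdn : ∀ j, c ≤ j → j ≤ Λ → Dn ((B : ℝ) / (q ^ (f - j) : ℕ)) N ε) (hc : c ≤ Λ)
    (hV : ((G : ℝ) - 1) * (1 / G + ε) ≤ 1) (hB : G * (B * D) ≤ q ^ f) (hI : Safe q G A f)
    (he : (q : ℝ) * Λ ≤ e0) (ha : |(digitSum q (A / q ^ f) : ℝ) - a| ≤ e0) :
    ∃ m < D, Safe q G (A + B * m) (f - Λ) ∧
      |(digitSum q ((A + B * m) / q ^ (f - Λ)) : ℝ) - (a + sg q * Λ)|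
        ≤ e0 + (5 * q / G * Λ + q * c) := by
  have hG0 : (0:ℝ) < G := by exact_mod_cast (show 0 < G by omega)
  have inv' : ∀ m, G * ((A + B * m) % q ^ (f - Λ)) / q ^ (f - Λ) ≠ G - 1 →
      Safe q G (A + B * m) (f - Λ) := by
    intro m hm
    unfold Safe
    have hQ : 0 < q ^ (f - Λ) := by positivity
    set x := (A + B * m) % q ^ (f - Λ) with hx
    have h0 : x < q ^ (f - Λ) := Nat.mod_lt _ hQ
    have h1 : G * x / q ^ (f - Λ) < G := by
      apply Nat.div_lt_of_lt_mul
      rw [mul_comm]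
      exact Nat.mul_lt_mul_of_pos_right h0 (by omega)
    exact (Nat.div_lt_iff_lt_mul hQ).1 (by omega)
  have dsw : ∀ m < D, digitSum q ((A + B * m) / q ^ (f - Λ)) =
      ∑ j ∈ range c, ((A + B * m) / q ^ (f - j - 1) % q) +
      ∑ j ∈ Ico c Λ, ((A + B * m) / q ^ (f - j - 1) % q) + digitSum q (A / q ^ f) := by
    intro m hm
    rw [ds_window_rev hq _ f Λ hΛf, hI.div_eq (by omega) (by omega), sum_range_add_sum_Ico _ hc]
    refine le_trans (Nat.mul_le_mul_left _ (Nat.mul_le_mul_left _ hm.le)) hB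
  have dg : ∀ m j, (A + B * m) / q ^ (f - j - 1) % q ≤ q - 1 := by
    intro m j
    have := Nat.mod_lt ((A + B * m) / q ^ (f - j - 1)) (show q > 0 by omega)
    omega
  have top : ∀ m, ∑ j ∈ range c, ((A + B * m) / q ^ (f - j - 1) % q) ≤ c * (q - 1) := by
    intro m
    calc _ ≤ ∑ j ∈ range c, (q - 1) := sum_le_sum fun j _ => dg m j
      _ = _ := by simp
  have hq1 : ((q - 1 : ℕ) : ℝ) = q - 1 := by push_cast [Nat.cast_sub hq.le]; ring
  have topR : ∀ m, (∑ j ∈ range c, (((A + B * m) / q ^ (f - j - 1) % q : ℕ) : ℝ)) ≤ c * (q - 1) := by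
    intro m; have := top m; rw [← hq1]; exact_mod_cast this
  have hq0 : (2:ℝ) ≤ q := by exact_mod_cast hq
  have hsg : sg q = ((q:ℝ) - 1) / 2 := rfl
  have hc0 : (0:ℝ) ≤ c := by positivity
  have hΛ0 : (0:ℝ) ≤ Λ := by positivity
  have hgs : ∑ d ∈ range q, d = q * (q - 1) / 2 := by exact sum_range_id q
  have hgs2 : (∑ d ∈ range q, d) * 2 = q * (q - 1) := sum_range_id_mul_two q
  have hE : (0:ℝ) ≤ 5 * q / G * Λ := by positivity
  rw [abs_le] at ha
  rcases le_total a (digitSum q (A / q ^ f) : ℝ) with hcase | hcase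
  · obtain ⟨m, hm, h1, h2⟩ := block_pick (A := A) hq hGH hG hD hN hΛ hΛf hdn hc hV (fun d => d) hgs2
    refine ⟨m, hm, inv' m h1, ?_⟩
    have hs : (digitSum q ((A + B * m) / q ^ (f - Λ)) : ℝ) =
      ∑ j ∈ range c, (((A + B * m) / q ^ (f - j - 1) % q : ℕ) : ℝ) +
      ∑ j ∈ Ico c Λ, (((A + B * m) / q ^ (f - j - 1) % q : ℕ) : ℝ) + digitSum q (A / q ^ f) := by
      rw [dsw m hm]; push_cast; ring
    have t1 := topR m
    have t0 : (0:ℝ) ≤ ∑ j ∈ range c, (((A + B * m) / q ^ (f - j - 1) % q : ℕ) : ℝ) := by positivity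
    have r0 : (0:ℝ) ≤ ∑ j ∈ Ico c Λ, (((A + B * m) / q ^ (f - j - 1) % q : ℕ) : ℝ) := by positivity
    set R := ∑ j ∈ Ico c Λ, (((A + B * m) / q ^ (f - j - 1) % q : ℕ) : ℝ)
    have h3 : R ≤ sg q * Λ + 5 * q / G * Λ := by
      have : G * R ≤ G * (sg q * Λ + 5 * q / G * Λ) := by
        refine h2.trans (le_of_eq ?_); field_simp
      exact le_of_mul_le_mul_left this hG0
    rw [hs, abs_le]
    constructor
    · have : sg q * Λ ≤ q * Λ := by rw [hsg]; nlinarith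
      have : (0:ℝ) ≤ q * c := by positivity
      linarith
    · linarith
  · have hw : (∑ d ∈ range q, (q - 1 - d)) * 2 = q * (q - 1) := by
      rw [sum_range_reflect (fun d => d) q]; exact hgs2
    obtain ⟨m, hm, h1, h2⟩ := block_pick (A := A) hq hGH hG hD hN hΛ hΛf hdn hc hV (fun d => q - 1 - d) hw
    refine ⟨m, hm, inv' m h1, ?_⟩
    have hs : (digitSum q ((A + B * m) / q ^ (f - Λ)) : ℝ) =
      ∑ j ∈ range c, (((A + B * m) / q ^ (f - j - 1) % q : ℕ) : ℝ) +
      ∑ j ∈ Ico c Λ, (((A + B * m) / q ^ (f - j - 1) % q : ℕ) : ℝ) + digitSum q (A / q ^ f) := by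
      rw [dsw m hm]; push_cast; ring
    have t1 := topR m
    have t0 : (0:ℝ) ≤ ∑ j ∈ range c, (((A + B * m) / q ^ (f - j - 1) % q : ℕ) : ℝ) := by positivity
    have r1 : ∑ j ∈ Ico c Λ, (((A + B * m) / q ^ (f - j - 1) % q : ℕ) : ℝ) ≤ (Λ - c) * (q - 1) := by
      calc _ ≤ ∑ j ∈ Ico c Λ, ((q - 1 : ℕ) : ℝ) := sum_le_sum fun j _ => by exact_mod_cast dg m j
        _ = _ := by rw [hq1]; simp [Nat.cast_sub hc]; ring
    have hrev : ∑ j ∈ Ico c Λ, (((fun d => q - 1 - d) ((A + B * m) / q ^ (f - j - 1) % q) : ℕ) : ℝ)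
        = (Λ - c) * (q - 1) - ∑ j ∈ Ico c Λ, (((A + B * m) / q ^ (f - j - 1) % q : ℕ) : ℝ) := by
      have : ((Λ : ℝ) - c) * (q - 1) = ∑ j ∈ Ico c Λ, ((q : ℝ) - 1) := by
        simp [Nat.cast_sub hc]; ring
      rw [this, ← sum_sub_distrib]
      apply sum_congr rfl
      intro j _
      simp only
      rw [Nat.cast_sub (dg m j), hq1]
    rw [hrev] at h2
    set R := ∑ j ∈ Ico c Λ, (((A + B * m) / q ^ (f - j - 1) % q : ℕ) : ℝ)
    have h3 : (Λ - c) * (q - 1) - R ≤ sg q * Λ + 5 * q / G * Λ := by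
      have : G * ((Λ - c) * (q - 1) - R) ≤ G * (sg q * Λ + 5 * q / G * Λ) := by
        refine h2.trans (le_of_eq ?_); field_simp
      exact le_of_mul_le_mul_left this hG0
    rw [hsg] at h3 ⊢
    rw [hs, abs_le]
    constructor
    · nlinarith
    · nlinarith

theorem bad_step {p q G A f Λ e : ℕ} {a e0 : ℝ} (hp : 1 < p) (hq : 1 < q) (hG : 2 * p ≤ G) (hG3 : 3 ≤ G)
    (hΛf : Λ ≤ f) (hGΛ : G ≤ q ^ Λ) (hI : Safe q G A f) (hpe : 2 * p ^ e ≤ q ^ (f - Λ))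
    (ha : |(digitSum q (A / q ^ f) : ℝ) - a| ≤ e0) :
    ∃ B, p ^ e ∣ B ∧ digitSum p B ≤ 1 ∧ Safe q G (A + B) (f - Λ) ∧
      |(digitSum q ((A + B) / q ^ (f - Λ)) : ℝ) - (a + sg q * Λ)| ≤ e0 + q * Λ := by
  obtain ⟨B, h1, h2, h3, h4⟩ : ∃ B, p ^ e ∣ B ∧ digitSum p B ≤ 1 ∧ Safe q G (A + B) (f - Λ) ∧
      B ≤ q ^ (f - Λ) := by
    by_cases hA : Safe q G A (f - Λ)
    · exact ⟨0, by simp, by simp [ds_zero], by simpa using hA, by simp⟩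
    set Q := q ^ (f - Λ) with hQ
    have hQ0 : 0 < Q := by positivity
    have hpe0 : 0 < p ^ e := by positivity
    have hk1 : p ^ (Nat.log p (Q / 2)) ≤ Q / 2 := Nat.pow_log_le_self p (by omega)
    have hk2 : Q / 2 < p ^ (Nat.log p (Q / 2) + 1) := Nat.lt_pow_succ_log_self hp _
    have hk3 : e ≤ Nat.log p (Q / 2) := Nat.le_log_of_pow_le hp (by omega)
    set k := Nat.log p (Q / 2)
    refine ⟨p ^ k, pow_dvd_pow p hk3, ?_, ?_, by omega⟩
    · have := ds_mul_pow hp k 1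
      rw [mul_one] at this
      rw [this, ds_lt hp hp]
    · unfold Safe at hA ⊢
      rw [← hQ] at hA ⊢
      have hr : A % Q < Q := Nat.mod_lt _ hQ0
      have e1 : Q < G * p ^ k := by
        rw [pow_succ] at hk2
        have : 2 * p * p ^ k ≤ G * p ^ k := Nat.mul_le_mul_right _ hG
        have : 2 * p * p ^ k = 2 * (p ^ k * p) := by ring
        omega
      have e2 : Q ≤ A % Q + p ^ k := by
        have : G * Q = (G - 1) * Q + Q := by
          obtain ⟨g, rfl⟩ : ∃ g, G = g + 1 := ⟨G - 1, by omega⟩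
          simp; ring
        have h5 : G * Q < G * (A % Q + p ^ k) := by rw [mul_add]; omega
        exact (Nat.lt_of_mul_lt_mul_left h5).le
      have e3 : (A + p ^ k) % Q = A % Q + p ^ k - Q := by
        rw [Nat.add_mod, Nat.mod_eq_of_lt (show p ^ k < Q by omega), Nat.mod_eq_sub_mod e2,
          Nat.mod_eq_of_lt (by omega)]
      rw [e3]
      have e4 : 2 * (A % Q + p ^ k - Q) < Q := by omega
      have e5 : 2 * (G * (A % Q + p ^ k - Q)) < 2 * ((G - 1) * Q) := by
        calc 2 * (G * (A % Q + p ^ k - Q)) = G * (2 * (A % Q + p ^ k - Q)) := by ring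
          _ < G * Q := Nat.mul_lt_mul_of_pos_left e4 (by omega)
          _ ≤ (2 * (G - 1)) * Q := Nat.mul_le_mul_right _ (by omega)
          _ = _ := by ring
      omega
  refine ⟨B, h1, h2, h3, ?_⟩
  have hB : G * B ≤ q ^ f := by
    calc G * B ≤ q ^ Λ * q ^ (f - Λ) := Nat.mul_le_mul hGΛ h4
      _ = q ^ f := by rw [← pow_add]; congr 1; omega
  have hs := ds_window_rev hq (A + B) f Λ hΛf
  rw [hI.div_eq (by omega) (by omega) hB] at hs
  have hw : ∑ j ∈ Finset.range Λ, ((A + B) / q ^ (f - j - 1) % q) ≤ Λ * (q - 1) := by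
    calc _ ≤ ∑ j ∈ Finset.range Λ, (q - 1) := Finset.sum_le_sum fun j _ => by
          have := Nat.mod_lt ((A + B) / q ^ (f - j - 1)) (show q > 0 by omega)
          omega
      _ = _ := by simp
  have hw' : ((∑ j ∈ Finset.range Λ, ((A + B) / q ^ (f - j - 1) % q) : ℕ) : ℝ) ≤ Λ * (q - 1) := by
    rw [show ((q:ℝ) - 1) = (q - 1 : ℕ) by push_cast [Nat.cast_sub hq.le]; ring]
    exact_mod_cast hw
  have hw0 : (0:ℝ) ≤ ((∑ j ∈ Finset.range Λ, ((A + B) / q ^ (f - j - 1) % q) : ℕ) : ℝ) := by positivity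
  have hq0 : (2:ℝ) ≤ q := by exact_mod_cast hq
  have hΛ0 : (0:ℝ) ≤ Λ := by positivity
  rw [hs, Nat.cast_add]
  unfold sg
  rw [abs_le] at ha ⊢
  constructor <;> nlinarith


open Finset in
theorem count_arc' {β ε len : ℝ} {N : ℕ} (h : Dn β N ε) (α u : ℝ) (K : ℕ)
    (h0 : 0 < len + ε) (h1 : len + ε ≤ 1) :
    (#{m ∈ range K | Int.fract (α + β * (m : ℕ) - u) < len} : ℝ) ≤ 2 * (len + ε) * (K + N) := by
  have h2 : 1 ≤ 1 / (len + ε) := by rw [le_div_iff₀ h0]; linarith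
  have h3 := Nat.floor_le (show 0 ≤ 1 / (len + ε) by positivity)
  have h4 := Nat.lt_floor_add_one (1 / (len + ε))
  have h5 : 1 ≤ ⌊1 / (len + ε)⌋₊ := Nat.le_floor (by simpa using h2)
  set V := ⌊1 / (len + ε)⌋₊
  have h6 := count_arc h α u K V (by rwa [le_div_iff₀ h0] at h3)
  set x := #{m ∈ range K | Int.fract (α + β * (m : ℕ) - u) < len}
  have h6' : (V : ℝ) * x ≤ K + N := by exact_mod_cast h6
  have h5' : (1:ℝ) ≤ V := by exact_mod_cast h5
  have h7 : 1 ≤ 2 * (len + ε) * V := by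
    rw [div_lt_iff₀ h0] at h4
    nlinarith
  have hx : (0:ℝ) ≤ x := by positivity
  calc (x : ℝ) ≤ 2 * (len + ε) * V * x := by nlinarith
    _ = 2 * (len + ε) * (V * x) := by ring
    _ ≤ _ := by gcongr

open Finset in
theorem union_count {ι : Type} (I : Finset ι) (u len : ι → ℝ) {β : ℝ} (hβ : Irrational β)
    {ε : ℝ} (hε : 0 < ε) (hl0 : ∀ a ∈ I, 0 ≤ len a) (hl : ∀ a ∈ I, len a ≤ 1 / 2) :
    ∃ N : ℕ, ∀ (α : ℝ) (J : ℕ) (P : ℕ → Prop) [DecidablePred P],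
      (∀ i < J, P i → ∃ a ∈ I, Int.fract (α + β * i - u a) < len a) →
      (#{i ∈ range J | P i} : ℝ) ≤ (2 * ∑ a ∈ I, len a + ε) * (J + N) := by
  classical
  set ε₂ : ℝ := min (1 / 2) (ε / (2 * (#I + 1))) with hε₂
  have hε₂0 : 0 < ε₂ := by positivity
  obtain ⟨N, -, hN⟩ := Dn_irrational hβ hε₂0
  refine ⟨N, ?_⟩
  intro α J P _ hP
  have hsub : ({i ∈ range J | P i} : Finset ℕ) ⊆
      I.biUnion fun a => {i ∈ range J | Int.fract (α + β * (i : ℕ) - u a) < len a} := by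
    intro i hi
    simp only [mem_filter, mem_range] at hi
    obtain ⟨a, ha, h⟩ := hP i hi.1 hi.2
    simp only [mem_biUnion, mem_filter, mem_range]
    exact ⟨a, ha, hi.1, h⟩
  have h1 : (#{i ∈ range J | P i} : ℝ) ≤
      ∑ a ∈ I, (#{i ∈ range J | Int.fract (α + β * (i : ℕ) - u a) < len a} : ℝ) := by
    exact_mod_cast (card_le_card hsub).trans card_biUnion_le
  refine h1.trans ?_
  calc _ ≤ ∑ a ∈ I, 2 * (len a + ε₂) * (J + N) := by
        apply sum_le_sum
        intro a ha
        apply count_arc' hN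
        · have := hl0 a ha; linarith
        · have := hl a ha
          have : ε₂ ≤ 1 / 2 := min_le_left _ _
          linarith
    _ = (2 * ∑ a ∈ I, len a + 2 * (#I * ε₂)) * (J + N) := by
        rw [← sum_mul, ← mul_sum, sum_add_distrib, sum_const, nsmul_eq_mul]; ring
    _ ≤ _ := by
        gcongr
        have : ε₂ ≤ ε / (2 * (#I + 1)) := min_le_right _ _
        have h3 : (#I : ℝ) * ε₂ ≤ (#I + 1) * (ε / (2 * (#I + 1))) := by
          gcongr; linarith
        have h4 : ((#I : ℝ) + 1) * (ε / (2 * (#I + 1))) = ε / 2 := by field_simp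
        linarith

/-- a bad approximation forces the mantissa into a short arc -/
theorem bad_arc {p q f j t l : ℕ} {z : ℤ} {η : ℝ} (hp : 1 < p) (hq : 1 < q) (hjf : j ≤ f)
    (hl : l ≤ Nat.log p (q ^ f)) (ht : 1 ≤ t) (hj : p ^ (l + 1) ≤ q ^ j) (hη0 : 0 < η) (hη : η ≤ 1 / 16)
    (hb : |(t : ℝ) * (((p ^ (Nat.log p (q ^ f) - l) : ℕ) : ℝ) / (q ^ (f - j) : ℕ)) - z| < η) :
    1 ≤ z ∧ z ≤ t * q ^ j + 1 ∧
    Int.fract (f * Real.logb p q - Real.logb p ((t : ℝ) * q ^ j / p ^ l / (z + η))) < 8 * η / z := by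
  have hp0 : (1:ℝ) < p := by exact_mod_cast hp
  have hq0 : (1:ℝ) < q := by exact_mod_cast hq
  have ht0 : (1:ℝ) ≤ t := by exact_mod_cast ht
  set K := Nat.log p (q ^ f) with hK
  set W : ℝ := (t : ℝ) * (((p ^ (K - l) : ℕ) : ℝ) / (q ^ (f - j) : ℕ)) with hW
  have hqf : (q:ℝ) ^ f = q ^ (f - j) * q ^ j := by rw [← pow_add]; congr 1; omega
  have hpK : (p:ℝ) ^ K = p ^ (K - l) * p ^ l := by rw [← pow_add]; congr 1; omega
  have hW' : W * p ^ l * q ^ f = t * q ^ j * p ^ K := by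
    rw [hW, hqf, hpK]; push_cast; field_simp
  have hK1 : (p:ℝ) ^ K ≤ q ^ f := by
    have : p ^ K ≤ q ^ f := Nat.pow_log_le_self p (by positivity)
    exact_mod_cast this
  have hK2 : (q:ℝ) ^ f < p ^ K * p := by
    have : q ^ f < p ^ (K + 1) := Nat.lt_pow_succ_log_self hp _
    rw [pow_succ] at this
    exact_mod_cast this
  have hj' : (p:ℝ) ^ l * p ≤ q ^ j := by
    rw [pow_succ] at hj
    exact_mod_cast hj
  have hqf0 : (0:ℝ) < q ^ f := by positivity
  have hpl0 : (0:ℝ) < p ^ l := by positivity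
  have hpK0 : (0:ℝ) < p ^ K := by positivity
  have hqj0 : (0:ℝ) < q ^ j := by positivity
  have hpl1 : (1:ℝ) ≤ p ^ l := one_le_pow₀ hp0.le
  have hW1 : 1 ≤ W := by
    have h1 : 1 * (p ^ l * q ^ f) ≤ W * ((p:ℝ) ^ l * q ^ f) := by
      calc 1 * ((p:ℝ) ^ l * q ^ f) ≤ p ^ l * (p ^ K * p) := by rw [one_mul]; gcongr
        _ = (p ^ l * p) * p ^ K := by ring
        _ ≤ q ^ j * p ^ K := by gcongr
        _ ≤ t * q ^ j * p ^ K := by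
            have : (0:ℝ) ≤ q ^ j * p ^ K := by positivity
            nlinarith
        _ = W * (p ^ l * q ^ f) := by rw [← hW']; ring
    exact le_of_mul_le_mul_right h1 (by positivity)
  have hW2 : W ≤ t * q ^ j := by
    have h1 : W * ((p:ℝ) ^ l * q ^ f) ≤ t * q ^ j * (p ^ l * q ^ f) := by
      calc W * ((p:ℝ) ^ l * q ^ f) = t * q ^ j * p ^ K := by rw [← hW']; ring
        _ ≤ t * q ^ j * (1 * q ^ f) := by rw [one_mul]; gcongr
        _ ≤ _ := by gcongr
    exact le_of_mul_le_mul_right h1 (by positivity)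
  rw [abs_lt] at hb
  have hz0 : (0:ℝ) < z := by linarith
  have hz1 : 1 ≤ z := by
    have : (0:ℤ) < z := by exact_mod_cast hz0
    omega
  have hz1' : (1:ℝ) ≤ z := by exact_mod_cast hz1
  refine ⟨hz1, ?_, ?_⟩
  · have : (z:ℝ) ≤ t * q ^ j + 1 := by linarith
    exact_mod_cast this
  · have hlp : 0 < Real.log p := Real.log_pos hp0
    have hlp2 : 1 / 2 < Real.log p := by
      have h2 : Real.log 2 ≤ Real.log p := Real.log_le_log (by norm_num) (by exact_mod_cast hp)
      have := Real.log_two_gt_d9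
      linarith
    have key : f * Real.logb p q - Real.logb p ((t : ℝ) * q ^ j / p ^ l / (z + η))
        = Real.logb p ((z + η) / W) + (K : ℕ) := by
      have e1 : (f:ℝ) * Real.logb p q = Real.logb p (q ^ f) := by rw [Real.logb_pow]
      have e2 : ((K : ℕ) : ℝ) = Real.logb p (p ^ K) := by
        rw [Real.logb_pow, Real.logb_self_eq_one hp0, mul_one]
      rw [e1, e2, ← Real.logb_div (by positivity) (by positivity), ← Real.logb_mul (by positivity) (by positivity)]
      congr 1
      have hWne : W ≠ 0 := by linarith
      have hzη : (z:ℝ) + η ≠ 0 := by linarith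
      field_simp
      linear_combination hW'
    rw [key, Int.fract_add_natCast]
    have hw0 : 0 ≤ Real.logb p ((z + η) / W) := by
      apply Real.logb_nonneg hp0
      rw [le_div_iff₀ (by linarith)]; linarith
    have hw1 : Real.logb p ((z + η) / W) < 8 * η / z := by
      rw [Real.logb, div_lt_iff₀ hlp]
      have h1 : Real.log ((z + η) / W) ≤ (z + η) / W - 1 := Real.log_le_sub_one_of_pos (by
        apply div_pos <;> linarith)
      have h2 : (z + η) / W - 1 < 4 * η / z := by
        rw [div_sub_one (by linarith), div_lt_div_iff₀ (by linarith) hz0]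
        nlinarith
      have h3 : 4 * η / z ≤ 8 * η / z * Real.log p := by
        have : 8 * η / z * (1 / 2) ≤ 8 * η / z * Real.log p := by gcongr
        calc 4 * η / z = 8 * η / z * (1 / 2) := by ring
          _ ≤ _ := this
      linarith
    refine lt_of_le_of_lt ?_ hw1
    have := Int.floor_nonneg.2 hw0
    have h4 : ((0:ℤ):ℝ) ≤ ⌊Real.logb p ((z + η) / W)⌋ := by exact_mod_cast this
    rw [Int.fract]
    push_cast at h4
    linarith


theorem irr_logb {p q : ℕ} (hp : 1 < p) (hq : 1 < q) (hco : Nat.Coprime p q) :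
    Irrational (Real.logb p q) := by
  rintro ⟨r, hr⟩
  have hp0 : (1:ℝ) < p := by exact_mod_cast hp
  have hq0 : (1:ℝ) < q := by exact_mod_cast hq
  have hpos : 0 < Real.logb p q := Real.logb_pos hp0 hq0
  have hr0 : 0 < r := by
    rw [← hr] at hpos
    exact_mod_cast hpos
  have hnum : 0 < r.num := Rat.num_pos.2 hr0
  obtain ⟨n, hn⟩ : ∃ n : ℕ, r.num = n := ⟨r.num.toNat, by omega⟩
  have h1 : (r.den : ℝ) * Real.logb p q = n := by
    rw [← hr]
    have : (r.den : ℚ) * r = n := by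
      rw [mul_comm, Rat.mul_den_eq_num, hn]; simp
    exact_mod_cast this
  have h2 : (q:ℝ) ^ r.den = p ^ n := by
    have h3 : Real.logb p ((q:ℝ) ^ r.den) = n := by rw [Real.logb_pow, h1]
    have h6 := Real.rpow_logb (b := (p:ℝ)) (x := (q:ℝ) ^ r.den) (by linarith) (by linarith)
      (by positivity)
    rw [h3, Real.rpow_natCast] at h6
    exact h6.symm
  have h4 : q ^ r.den = p ^ n := by exact_mod_cast h2
  have h5 : Nat.Coprime (q ^ r.den) (p ^ n) := Nat.Coprime.pow _ _ hco.symm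
  rw [h4, Nat.coprime_self] at h5
  have : n ≠ 0 := by omega
  have := Nat.one_lt_pow this hp
  omega

/-- badly approximable-from-below failure at block height `f` -/
def BadB (p q c Λ T l : ℕ) (η : ℝ) (f : ℕ) : Prop :=
  ∃ j t : ℕ, ∃ z : ℤ, c ≤ j ∧ j ≤ Λ ∧ 1 ≤ t ∧ t ≤ T ∧
    |(t : ℝ) * (((p ^ (Nat.log p (q ^ f) - l) : ℕ) : ℝ) / (q ^ (f - j) : ℕ)) - z| < η

open Finset in
theorem bad_total {p q c Λ T l : ℕ} {η ε : ℝ} (hp : 1 < p) (hq : 1 < q) (hco : Nat.Coprime p q)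
    (hc : p ^ (l + 1) ≤ q ^ c) (hΛ : 0 < Λ) (hη0 : 0 < η) (hη : η ≤ 1 / 16) (hε : 0 < ε)
    (hs : 16 * η * (Λ + 1) * T * (1 + Real.log (T * q ^ Λ + 1)) ≤ ε / 2) :
    ∃ N : ℕ, ∀ (t0 J : ℕ) (P : ℕ → Prop) [DecidablePred P],
      (∀ i < J, P i → BadB p q c Λ T l η (t0 + (J - i) * Λ)) →
      (∀ i < J, l ≤ Nat.log p (q ^ (t0 + (J - i) * Λ))) →
      (#{i ∈ range J | P i} : ℝ) ≤ ε * (J + N) := by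
  set Z := T * q ^ Λ + 1 with hZ
  set I : Finset (ℕ × ℕ × ℕ) := range (Λ + 1) ×ˢ Icc 1 T ×ˢ Icc 1 Z with hI
  have hirr : Irrational (-((Λ : ℝ) * Real.logb p q)) :=
    ((irr_logb hp hq hco).natCast_mul hΛ.ne').neg
  obtain ⟨N, hN⟩ := union_count I
    (fun a => Real.logb p ((a.2.1 : ℝ) * q ^ a.1 / p ^ l / ((a.2.2 : ℕ) + η)))
    (fun a => 8 * η / (a.2.2 : ℕ)) hirr (half_pos hε)
    (fun a _ => by positivity)
    (fun a ha => by
      simp only [hI, mem_product, mem_Icc] at ha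
      have : (1:ℝ) ≤ (a.2.2 : ℕ) := by exact_mod_cast ha.2.2.1
      rw [div_le_iff₀ (by linarith)]
      linarith)
  refine ⟨N, ?_⟩
  intro t0 J P _ hP hl
  have h1 := hN ((t0 + J * Λ : ℕ) * Real.logb p q) J P ?_
  · refine h1.trans ?_
    gcongr
    have h2 : ∑ a ∈ I, 8 * η / ((a.2.2 : ℕ) : ℝ) = 8 * η * (Λ + 1) * T * ∑ z ∈ Icc 1 Z, ((z : ℕ) : ℝ)⁻¹ := by
      have inner : ∑ x ∈ Icc 1 T ×ˢ Icc 1 Z, 8 * η / ((x.2 : ℕ) : ℝ)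
          = 8 * η * T * ∑ z ∈ Icc 1 Z, ((z : ℕ) : ℝ)⁻¹ := by
        rw [sum_product]
        dsimp only
        rw [sum_const, Nat.card_Icc, nsmul_eq_mul, mul_sum, mul_sum]
        apply sum_congr rfl
        intro z _
        simp only [Nat.add_sub_cancel]
        ring
      rw [hI, sum_product]
      dsimp only
      rw [sum_const, card_range, nsmul_eq_mul, inner]
      push_cast
      ring
    have h3 : ∑ z ∈ Icc 1 Z, ((z : ℕ) : ℝ)⁻¹ ≤ 1 + Real.log (T * q ^ Λ + 1) := by
      have h4 := harmonic_le_one_add_log Z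
      rw [harmonic_eq_sum_Icc] at h4
      push_cast [hZ] at h4 ⊢
      exact h4
    have h5 : 0 ≤ 8 * η * (Λ + 1) * T := by positivity
    have := mul_le_mul_of_nonneg_left h3 h5
    rw [h2]
    linarith
  · intro i hi hPi
    obtain ⟨j, t, z, hcj, hjΛ, ht, htT, hb⟩ := hP i hi hPi
    have hjf : j ≤ t0 + (J - i) * Λ := by
      have : 1 * Λ ≤ (J - i) * Λ := Nat.mul_le_mul_right _ (by omega)
      omega
    obtain ⟨b1, b2, b3⟩ := bad_arc hp hq hjf (hl i hi) ht
      (hc.trans (Nat.pow_le_pow_right (by omega) hcj)) hη0 hη hb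
    obtain ⟨y, rfl⟩ : ∃ y : ℕ, z = y := ⟨z.toNat, by omega⟩
    refine ⟨(j, t, y), ?_, ?_⟩
    · simp only [hI, mem_product, mem_range, mem_Icc]
      refine ⟨by omega, ⟨ht, htT⟩, by omega, ?_⟩
      have e1 : y ≤ t * q ^ j + 1 := by exact_mod_cast b2
      have e2 : t * q ^ j ≤ T * q ^ Λ := Nat.mul_le_mul htT (Nat.pow_le_pow_right (by omega) hjΛ)
      omega
    · simp only [Int.cast_natCast] at b3
      refine lt_of_eq_of_lt ?_ b3
      congr 1
      push_cast [Nat.cast_sub hi.le]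
      ring


open Finset in
theorem chain {p q H G ℓ N c Λ e t0 J : ℕ} {ε : ℝ} (hp : 1 < p) (hq : 1 < q) (hGH : G = q * H)
    (hG : 8 ≤ G) (hGp : 2 * p ≤ G) (hN : N * G ≤ p ^ ℓ) (hΛ : 0 < Λ) (hc : c ≤ Λ)
    (hV : ((G : ℝ) - 1) * (1 / G + ε) ≤ 1) (hGΛ : G ≤ q ^ Λ) (hpe : 2 * p ^ e ≤ q ^ t0)
    (P : ℕ → Prop) [DecidablePred P]
    (hP : ∀ i < J, P i → ∃ k, e ≤ k ∧ G * (p ^ k * p ^ ℓ) ≤ q ^ (t0 + (J - i) * Λ) ∧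
      ∀ j, c ≤ j → j ≤ Λ → Dn (((p ^ k : ℕ) : ℝ) / (q ^ (t0 + (J - i) * Λ - j) : ℕ)) N ε)
    (i : ℕ) (hi : i ≤ J) :
    ∃ A, p ^ e ∣ A ∧ digitSum p A ≤ i * (ℓ * (p - 1) + 1) ∧ Safe q G A (t0 + (J - i) * Λ) ∧
      |(digitSum q (A / q ^ (t0 + (J - i) * Λ)) : ℝ) - i * (sg q * Λ)| ≤
        q * Λ + i * (5 * q / G * Λ + q * c) + q * Λ * #{i' ∈ range i | ¬ P i'} := by
  induction i with
  | zero =>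
    refine ⟨0, by simp, by simp [ds_zero], ?_, ?_⟩
    · unfold Safe
      have : 0 < (G - 1) * q ^ (t0 + (J - 0) * Λ) := Nat.mul_pos (by omega) (by positivity)
      simpa using this
    · simp [ds_zero]; positivity
  | succ i ih =>
    obtain ⟨A, h1, h2, h3, h4⟩ := ih (by omega)
    have hf : Λ ≤ t0 + (J - i) * Λ := by
      have : 1 * Λ ≤ (J - i) * Λ := Nat.mul_le_mul_right _ (by omega)
      omega
    have hf' : t0 + (J - (i + 1)) * Λ = t0 + (J - i) * Λ - Λ := by
      obtain ⟨s, hs⟩ : ∃ s, J - i = s + 1 := ⟨J - i - 1, by omega⟩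
      rw [show J - (i + 1) = s by omega, hs, add_mul]
      omega
    have hge : (q:ℝ) * Λ ≤ q * Λ + i * (5 * q / G * Λ + q * c) + q * Λ * #{i' ∈ range i | ¬ P i'} := by
      have : (0:ℝ) ≤ i * (5 * q / G * Λ + q * c) + q * Λ * #{i' ∈ range i | ¬ P i'} := by positivity
      linarith
    by_cases hPi : P i
    · obtain ⟨k, k1, k2, k3⟩ := hP i (by omega) hPi
      obtain ⟨m, hm, m1, m2⟩ := good_step hq hGH hG (by positivity) hN hΛ hf k3 hc hV k2 h3 hge h4
      refine ⟨A + p ^ k * m, ?_, ?_, ?_, ?_⟩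
      · exact Dvd.dvd.add h1 (Dvd.dvd.mul_right (pow_dvd_pow p k1) m)
      · have e1 := ds_sub hp A (p ^ k * m)
        rw [ds_mul_pow hp] at e1
        have e2 := ds_le hp ℓ hm
        have : (i + 1) * (ℓ * (p - 1) + 1) = i * (ℓ * (p - 1) + 1) + (ℓ * (p - 1) + 1) := by ring
        omega
      · rw [hf']; exact m1
      · rw [hf']
        have hcard : #{i' ∈ range (i + 1) | ¬ P i'} = #{i' ∈ range i | ¬ P i'} := by
          rw [range_add_one, filter_insert, if_neg (by simpa using hPi)]
        rw [hcard]
        have e3 : ((i + 1 : ℕ) : ℝ) * (sg q * Λ) = i * (sg q * Λ) + sg q * Λ := by push_cast; ring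
        rw [e3]
        refine m2.trans (le_of_eq ?_)
        push_cast; ring
    · obtain ⟨B, b1, b2, b3, b4⟩ := bad_step (e := e) hp hq hGp (by omega) hf hGΛ h3
        (hpe.trans (Nat.pow_le_pow_right (by omega) (by rw [← hf']; omega))) h4
      refine ⟨A + B, Dvd.dvd.add h1 b1, ?_, ?_, ?_⟩
      · have e1 := ds_sub hp A B
        have : (i + 1) * (ℓ * (p - 1) + 1) = i * (ℓ * (p - 1) + 1) + (ℓ * (p - 1) + 1) := by ring
        have : 0 ≤ ℓ * (p - 1) := Nat.zero_le _
        omega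
      · rw [hf']; exact b3
      · rw [hf']
        have hcard : #{i' ∈ range (i + 1) | ¬ P i'} = #{i' ∈ range i | ¬ P i'} + 1 := by
          rw [range_add_one, filter_insert, if_pos hPi, card_insert_of_notMem (by simp)]
        rw [hcard]
        have e3 : ((i + 1 : ℕ) : ℝ) * (sg q * Λ) = i * (sg q * Λ) + sg q * Λ := by push_cast; ring
        rw [e3]
        refine b4.trans ?_
        have : (0:ℝ) ≤ 5 * q / G * Λ + q * c := by positivity
        push_cast
        linarith

theorem pick_len {p : ℕ} (hp : 1 < p) (T G E L0 : ℕ) {κ : ℝ} (hκ : 0 < κ) :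
    ∃ ℓ : ℕ, L0 ≤ ℓ ∧ T * (⌈1 / (κ / ((E * ℓ : ℕ) + 1 : ℝ) ^ 2)⌉₊ + 1) * G ≤ p ^ ℓ := by
  have hp0 : (1:ℝ) < p := by exact_mod_cast hp
  set C : ℝ := T * G * ((E + 1 : ℝ) ^ 2 / κ + 2) + 1 with hC
  have hC0 : 0 < C := by positivity
  have h1 := (tendsto_pow_const_div_const_pow_of_one_lt 2 hp0).eventually_lt_const
    (show (0:ℝ) < 1 / C by positivity)
  obtain ⟨ℓ, hℓ, hℓ'⟩ := (h1.and (Filter.eventually_ge_atTop (max L0 1))).exists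
  refine ⟨ℓ, le_trans (le_max_left _ _) hℓ', ?_⟩
  have hℓ1 : (1:ℝ) ≤ ℓ := by exact_mod_cast le_trans (le_max_right _ _) hℓ'
  rw [div_lt_div_iff₀ (by positivity) hC0] at hℓ
  have h2 : (⌈1 / (κ / ((E * ℓ : ℕ) + 1 : ℝ) ^ 2)⌉₊ : ℝ) ≤ (E + 1 : ℝ) ^ 2 / κ * ℓ ^ 2 + 1 := by
    refine (Nat.ceil_lt_add_one (by positivity)).le.trans ?_
    rw [one_div_div]
    have : ((E * ℓ : ℕ) + 1 : ℝ) ≤ (E + 1) * ℓ := by push_cast; nlinarith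
    have h3 : ((E * ℓ : ℕ) + 1 : ℝ) ^ 2 / κ ≤ ((E + 1) * ℓ) ^ 2 / κ := by gcongr
    have h4 : (((E:ℝ) + 1) * ℓ) ^ 2 / κ = (E + 1 : ℝ) ^ 2 / κ * ℓ ^ 2 := by ring
    linarith
  have h5 : ((T * (⌈1 / (κ / ((E * ℓ : ℕ) + 1 : ℝ) ^ 2)⌉₊ + 1) * G : ℕ) : ℝ) ≤ ((p ^ ℓ : ℕ) : ℝ) := by
    rw [Nat.cast_mul, Nat.cast_mul, Nat.cast_add]
    have h6 : (1:ℝ) ≤ ℓ ^ 2 := one_le_pow₀ hℓ1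
    calc (T:ℝ) * ((⌈1 / (κ / ((E * ℓ : ℕ) + 1 : ℝ) ^ 2)⌉₊ : ℕ) + (1 : ℕ)) * G
        ≤ T * (((E + 1 : ℝ) ^ 2 / κ * ℓ ^ 2 + 1) + 1) * G := by
          push_cast at h2 ⊢
          gcongr
      _ ≤ T * (((E + 1 : ℝ) ^ 2 / κ + 2) * ℓ ^ 2) * G := by gcongr; nlinarith
      _ ≤ ℓ ^ 2 * C := by rw [hC]; nlinarith
      _ ≤ _ := by push_cast; linarith
  exact_mod_cast h5


theorem hs_aux {T q Λ : ℕ} {η κ ε₃ : ℝ} (hT : 0 < T) (hq : 1 < q)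
    (hη : η = κ / ((Λ : ℕ) + 1 : ℝ) ^ 2) (hκ : κ = ε₃ / (32 * T * (T + q + 1))) (h0 : 0 < ε₃) :
    16 * η * (Λ + 1) * T * (1 + Real.log (T * q ^ Λ + 1)) ≤ ε₃ / 2 := by
  have hq0 : (2:ℝ) ≤ q := by exact_mod_cast hq
  have hT1 : (1:ℝ) ≤ T := by exact_mod_cast hT
  have hL0 : (0:ℝ) ≤ Λ := by positivity
  have l1 : Real.log (T * (q:ℝ) ^ Λ + 1) ≤ T + Λ * q := by
    have hqΛ : (1:ℝ) ≤ q ^ Λ := one_le_pow₀ (by linarith)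
    calc Real.log (T * (q:ℝ) ^ Λ + 1) ≤ Real.log ((T + 1) * q ^ Λ) := by
          apply Real.log_le_log (by positivity); linarith
      _ = Real.log (T + 1) + Λ * Real.log q := by
          rw [Real.log_mul (by positivity) (by positivity), Real.log_pow]
      _ ≤ T + Λ * q := by
          have a1 := Real.log_le_sub_one_of_pos (show (0:ℝ) < T + 1 by positivity)
          have a2 := Real.log_le_sub_one_of_pos (show (0:ℝ) < q by positivity)
          have : (Λ:ℝ) * Real.log q ≤ Λ * q := by gcongr; linarith
          linarith
  have l2 : 1 + Real.log (T * (q:ℝ) ^ Λ + 1) ≤ (Λ + 1) * (T + q + 1) := by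
    have h1 : (0:ℝ) ≤ Λ * T := by positivity
    have h2 : ((Λ:ℝ) + 1) * (T + q + 1) = Λ * T + Λ * q + Λ + T + q + 1 := by ring
    rw [h2]; linarith
  have hκ0 : 0 < κ := by rw [hκ]; positivity
  have hη0 : 0 < η := by rw [hη]; positivity
  have e1 : η * ((Λ:ℝ) + 1) ^ 2 = κ := by rw [hη]; field_simp
  have e2 : κ * (32 * T * (T + q + 1)) = ε₃ := by rw [hκ]; field_simp
  have c0 : 0 ≤ 16 * η * ((Λ:ℝ) + 1) * T := by positivity
  calc 16 * η * (Λ + 1) * T * (1 + Real.log (T * q ^ Λ + 1))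
      ≤ 16 * η * (Λ + 1) * T * ((Λ + 1) * (T + q + 1)) := mul_le_mul_of_nonneg_left l2 c0
    _ = 16 * (η * ((Λ:ℝ) + 1) ^ 2) * T * (T + q + 1) := by ring
    _ = (κ * (32 * T * (T + q + 1))) / 2 := by rw [e1]; ring
    _ = ε₃ / 2 := by rw [e2]

set_option maxHeartbeats 2000000 in
open Finset in
/-- numbers with few nonzero digits in base `p` and prescribed digit sum in base `q` -/
theorem sparse {p q : ℕ} (hp : 1 < p) (hq : 1 < q) (hco : Nat.Coprime p q) {ε : ℝ} (hε : 0 < ε)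
    (hε1 : ε ≤ 1) :
    ∃ C : ℕ, ∀ e Y : ℕ, ∃ A f : ℕ, p ^ e ∣ A ∧ (digitSum p A : ℝ) ≤ ε * Y + C ∧
      q ^ f ≤ C * p ^ e ∧ |(digitSum q (A / q ^ f) : ℝ) - Y| ≤ ε * Y + C ∧
      A % q ^ f + p ^ e ≤ q ^ f := by
  classical
  have hp0 : (2:ℝ) ≤ p := by exact_mod_cast hp
  have hq0 : (2:ℝ) ≤ q := by exact_mod_cast hq
  -- constants
  obtain ⟨H, hH⟩ := exists_nat_ge ((40 : ℝ) / ε + 8 + 2 * p)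
  have hH0 : 0 < H := by
    have : (0:ℝ) < H := by
      have : 0 < 40 / ε := by positivity
      linarith
    exact_mod_cast this
  set G := q * H with hGH
  have hGH' : (G : ℝ) = q * H := by rw [hGH]; push_cast; ring
  have hHG : H ≤ G := by rw [hGH]; exact Nat.le_mul_of_pos_left _ (by omega)
  have hHGr : (H : ℝ) ≤ G := by exact_mod_cast hHG
  have hεpos : 0 < 40 / ε := by positivity
  have hG8 : 8 ≤ G := by
    have : (8:ℝ) ≤ G := by linarith
    exact_mod_cast this
  have hG2p : 2 * p ≤ G := by
    have : (2:ℝ) * p ≤ G := by linarith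
    exact_mod_cast this
  have hG8r : (8:ℝ) ≤ G := by exact_mod_cast hG8
  have hqG : 10 * q / (G:ℝ) ≤ ε / 4 := by
    rw [hGH', div_le_iff₀ (by positivity)]
    have h1 : 40 / ε ≤ H := by linarith
    rw [div_le_iff₀ hε] at h1
    nlinarith
  set T := G ^ 2 with hT
  have hT0 : 0 < T := by positivity
  have hV : ((G : ℝ) - 1) * (1 / G + 1 / (T + 1 : ℝ)) ≤ 1 := by
    rw [hT]; push_cast
    have : ((G:ℝ) - 1) * (1 / ((G:ℝ) ^ 2 + 1)) ≤ 1 / G := by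
      rw [mul_one_div, div_le_div_iff₀ (by positivity) (by positivity)]; nlinarith
    have h2 : ((G:ℝ) - 1) * (1 / G) = 1 - 1 / G := by field_simp
    rw [mul_add, h2]; linarith
  obtain ⟨E, hE⟩ := exists_nat_ge ((16 : ℝ) * p * q / ε + 2 * p)
  have hE1 : 16 * p * q ≤ ε * E := by
    have : (16 : ℝ) * p * q / ε ≤ E := by linarith
    rw [div_le_iff₀ hε] at this
    linarith
  have hEp : 2 * p ≤ E := by
    have : (0:ℝ) ≤ 16 * p * q / ε := by positivity
    have : (2:ℝ) * p ≤ E := by linarith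
    exact_mod_cast this
  have hE0 : (0:ℝ) < E := by
    have : 0 < E := by omega
    exact_mod_cast this
  set ε₃ : ℝ := ε / (8 * q) with hε₃
  have hε₃0 : 0 < ε₃ := by positivity
  have hε₃1 : ε₃ ≤ 1 := by rw [hε₃, div_le_one (by positivity)]; linarith
  set κ : ℝ := ε₃ / (32 * T * (T + q + 1)) with hκ
  have hT1 : (1:ℝ) ≤ T := by exact_mod_cast hT0
  have hκ0 : 0 < κ := by positivity
  have hκ1 : κ ≤ 1 / 16 := by
    rw [hκ, div_le_div_iff₀ (by positivity) (by norm_num)]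
    nlinarith
  obtain ⟨ℓ, hℓ, hℓN⟩ := pick_len hp T G E (G + 1) hκ0
  set Λ := E * ℓ with hΛ
  set η : ℝ := κ / ((Λ : ℕ) + 1 : ℝ) ^ 2 with hη
  set N := T * (⌈1 / η⌉₊ + 1) with hN
  have hη0 : 0 < η := by positivity
  have hη1 : η ≤ 1 / 16 := by
    refine le_trans (div_le_self hκ0.le ?_) hκ1
    apply one_le_pow₀
    have : (0:ℝ) ≤ Λ := by positivity
    linarith
  set l := ℓ + G with hl
  set c := p * (l + 1) with hc
  have hpc : p ^ (l + 1) ≤ q ^ c := by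
    rw [hc, pow_mul]
    apply Nat.pow_le_pow_left
    exact (Nat.lt_two_pow_self).le.trans (Nat.pow_le_pow_left hq p)
  have hc2 : c ≤ 2 * p * ℓ := by
    rw [hc, hl, show 2 * p * ℓ = p * (2 * ℓ) by ring]
    exact Nat.mul_le_mul_left _ (by omega)
  have hcΛ : c ≤ Λ := hc2.trans (Nat.mul_le_mul_right _ hEp)
  have hΛ0 : 0 < Λ := by
    have : 0 < c := by rw [hc]; positivity
    omega
  have hΛr : (0:ℝ) < Λ := by exact_mod_cast hΛ0
  have hGΛ : G ≤ q ^ Λ := by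
    calc G ≤ q ^ G := (Nat.lt_pow_self hq).le
      _ ≤ q ^ Λ := Nat.pow_le_pow_right (by omega) (by
        have : G ≤ c := by rw [hc, hl]; nlinarith
        omega)
  have hs : 16 * η * (Λ + 1) * T * (1 + Real.log (T * q ^ Λ + 1)) ≤ ε₃ / 2 :=
    hs_aux hT0 hq hη hκ hε₃0
  obtain ⟨N₂, hN₂⟩ := bad_total hp hq hco hpc hΛ0 hη0 hη1 hε₃0 hs
  have hsg := sg_pos hq
  have hsg2 : 1 / 2 ≤ sg q := by unfold sg; linarith
  obtain ⟨C, hC⟩ := exists_nat_ge ((q:ℝ) * Λ + q * Λ * (ε₃ * N₂) + sg q * Λ + q * G)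
  have hCpos1 : (0:ℝ) ≤ q * Λ + q * Λ * (ε₃ * N₂) + sg q * Λ := by positivity
  have hCqG : q * G ≤ C := by
    have : (q:ℝ) * G ≤ C := by linarith
    exact_mod_cast this
  refine ⟨C, ?_⟩
  intro e Y
  set t0 := Nat.log q (G * p ^ e) + 1 with ht0
  have hpe0 : 0 < p ^ e := by positivity
  have ht1 : q ^ t0 ≤ C * p ^ e := by
    have h1 : q ^ Nat.log q (G * p ^ e) ≤ G * p ^ e := Nat.pow_log_le_self q (by positivity)
    calc q ^ t0 = q * q ^ Nat.log q (G * p ^ e) := by rw [ht0, pow_succ]; ring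
      _ ≤ q * (G * p ^ e) := Nat.mul_le_mul_left _ h1
      _ = (q * G) * p ^ e := by ring
      _ ≤ _ := Nat.mul_le_mul_right _ hCqG
  have ht2 : G * p ^ e < q ^ t0 := Nat.lt_pow_succ_log_self hq _
  set J := ⌊(Y : ℝ) / (sg q * Λ)⌋₊ with hJ
  have hJ1 : J * (sg q * Λ) ≤ Y := by
    have := Nat.floor_le (show (0:ℝ) ≤ (Y : ℝ) / (sg q * Λ) by positivity)
    rwa [le_div_iff₀ (by positivity)] at this
  have hJ2 : (Y:ℝ) < J * (sg q * Λ) + sg q * Λ := by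
    have := Nat.lt_floor_add_one ((Y : ℝ) / (sg q * Λ))
    rw [div_lt_iff₀ (by positivity)] at this
    linarith
  have hJ0 : (0:ℝ) ≤ J := by positivity
  have hJΛ : (J:ℝ) * Λ ≤ 2 * Y := by
    have : (J:ℝ) * Λ * (1 / 2) ≤ J * Λ * sg q := by gcongr
    linarith
  -- logs
  have hlog : ∀ i < J, e + l ≤ Nat.log p (q ^ (t0 + (J - i) * Λ)) := by
    intro i hi
    apply Nat.le_log_of_pow_le hp
    have h1 : 1 * Λ ≤ (J - i) * Λ := Nat.mul_le_mul_right _ (by omega)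
    calc p ^ (e + l) = p ^ e * p ^ l := pow_add _ _ _
      _ ≤ q ^ t0 * q ^ Λ := by
          apply Nat.mul_le_mul
          · nlinarith
          · exact (Nat.pow_le_pow_right (by omega) (by omega)).trans
              (hpc.trans (Nat.pow_le_pow_right (by omega) hcΛ))
      _ = q ^ (t0 + Λ) := (pow_add _ _ _).symm
      _ ≤ _ := Nat.pow_le_pow_right (by omega) (by omega)
  obtain ⟨A, a1, a2, a3, a4⟩ := chain (e := e) (t0 := t0) (J := J) (ε := 1 / (T + 1 : ℝ)) hp hq hGH
    hG8 hG2p hℓN hΛ0 hcΛ hV hGΛ (by nlinarith)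
    (fun i => ¬ BadB p q c Λ T l η (t0 + (J - i) * Λ)) (by
      intro i hi hgood
      have hlg := hlog i hi
      refine ⟨Nat.log p (q ^ (t0 + (J - i) * Λ)) - l, by omega, ?_, ?_⟩
      · have h1 : G ≤ p ^ G := (Nat.lt_pow_self hp).le
        calc G * (p ^ (Nat.log p (q ^ (t0 + (J - i) * Λ)) - l) * p ^ ℓ)
            ≤ p ^ G * (p ^ (Nat.log p (q ^ (t0 + (J - i) * Λ)) - l) * p ^ ℓ) :=
              Nat.mul_le_mul_right _ h1
          _ = p ^ (Nat.log p (q ^ (t0 + (J - i) * Λ))) := by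
              rw [← pow_add, ← pow_add]; congr 1; omega
          _ ≤ _ := Nat.pow_log_le_self p (by positivity)
      · intro j hj1 hj2
        apply Dn_of_good hT0 hη0 le_rfl
        intro t ht1 ht2 z
        by_contra hcon
        rw [not_le] at hcon
        exact hgood ⟨j, t, z, hj1, hj2, ht1, ht2, hcon⟩) J le_rfl
  have hbc := hN₂ t0 J (fun i => ¬ ¬ BadB p q c Λ T l η (t0 + (J - i) * Λ))
    (fun i _ h => not_not.1 h) (fun i hi => by have := hlog i hi; omega)
  rw [Nat.sub_self, zero_mul, add_zero] at a3 a4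
  refine ⟨A, t0, a1, ?_, ht1, ?_, ?_⟩
  · have h1 : ((digitSum p A : ℕ) : ℝ) ≤ J * (ℓ * p) := by
      have : digitSum p A ≤ J * (ℓ * p) := by
        refine a2.trans (Nat.mul_le_mul_left _ ?_)
        obtain ⟨r, rfl⟩ : ∃ r, p = r + 1 := ⟨p - 1, by omega⟩
        simp only [Nat.add_sub_cancel, mul_add]
        omega
      exact_mod_cast this
    have h2 : E * ((J:ℝ) * (ℓ * p)) ≤ E * (ε * Y) := by
      calc E * ((J:ℝ) * (ℓ * p)) = (J * Λ) * p := by rw [hΛ]; push_cast; ring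
        _ ≤ (2 * Y) * p := by gcongr
        _ ≤ (16 * p * q) * Y := by
            have : (0:ℝ) ≤ p * Y := by positivity
            nlinarith
        _ ≤ (ε * E) * Y := by gcongr
        _ = _ := by ring
    have h3 := le_of_mul_le_mul_left h2 hE0
    have : (0:ℝ) ≤ C := by positivity
    linarith
  · have hcΛr : (q:ℝ) * (J * c) ≤ ε / 4 * Y := by
      have h1 : E * ((q:ℝ) * (J * c)) ≤ E * (ε / 4 * Y) := by
        have hc2r : (c:ℝ) ≤ 2 * p * ℓ := by exact_mod_cast hc2
        calc E * ((q:ℝ) * (J * c)) ≤ E * (q * (J * (2 * p * ℓ))) := by gcongr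
          _ = 2 * p * q * (J * Λ) := by rw [hΛ]; push_cast; ring
          _ ≤ 2 * p * q * (2 * Y) := by gcongr
          _ = 16 * p * q * (Y / 4) := by ring
          _ ≤ ε * E * (Y / 4) := by gcongr
          _ = _ := by ring
      exact le_of_mul_le_mul_left h1 hE0
    have hg : (J:ℝ) * (5 * q / G * Λ) ≤ ε / 4 * Y := by
      calc (J:ℝ) * (5 * q / G * Λ) = (10 * q / G) / 2 * (J * Λ) := by ring
        _ ≤ (ε / 4) / 2 * (2 * Y) := by gcongr
        _ = _ := by ring
    have hb : (q:ℝ) * Λ * (ε₃ * J) ≤ ε / 4 * Y := by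
      calc (q:ℝ) * Λ * (ε₃ * J) = q * ε₃ * (J * Λ) := by ring
        _ ≤ q * ε₃ * (2 * Y) := by gcongr
        _ = ε / 4 * Y := by rw [hε₃]; field_simp; ring
    have hb2 := mul_le_mul_of_nonneg_left hbc (show (0:ℝ) ≤ q * Λ by positivity)
    have hY0 : (0:ℝ) ≤ ε * Y := by positivity
    have hqG0 : (0:ℝ) ≤ q * G := by positivity
    have tot : (q:ℝ) * Λ + J * (5 * q / G * Λ + q * c) + q * Λ *
        #{i' ∈ range J | ¬ ¬ BadB p q c Λ T l η (t0 + (J - i') * Λ)} ≤ ε * Y + C - sg q * Λ := by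
      have e1 : (q:ℝ) * Λ * (ε₃ * (J + N₂)) = q * Λ * (ε₃ * J) + q * Λ * (ε₃ * N₂) := by ring
      have e2 : (J:ℝ) * (5 * q / G * Λ + q * c) = J * (5 * q / G * Λ) + q * (J * c) := by ring
      rw [e2]
      linarith
    have a5 := a4.trans tot
    rw [abs_le] at a5 ⊢
    constructor <;> linarith
  · unfold Safe at a3
    have h1 : G * (A % q ^ t0 + p ^ e) ≤ G * q ^ t0 := by
      have : G * q ^ t0 = (G - 1) * q ^ t0 + q ^ t0 := by
        obtain ⟨g, hg⟩ : ∃ g, G = g + 1 := ⟨G - 1, by omega⟩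
        rw [hg]; simp; ring
      rw [mul_add]; omega
    exact Nat.le_of_mul_le_mul_left h1 (by omega)


theorem params {p q a b np : ℕ} (hp : 1 < p) (hq : 1 < q) (h1 : p * q ^ b * q ^ b ≤ p ^ np)
    (h2 : q * p ^ a * q ^ b ≤ p ^ np) :
    ∃ M nq : ℕ, q ^ b * M ≤ p ^ np ∧ p ^ np ≤ q * (q ^ b * M) ∧ p ^ a * M ≤ q ^ nq ∧
      q ^ nq < q * (p ^ a * M) ∧ p * q ^ b ≤ M ∧ q * p ^ a ≤ M := by
  have hb : 0 < q ^ b := by positivity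
  have ha : 0 < p ^ a := by positivity
  have e1 : p * q ^ b ≤ p ^ np / q ^ b := by rwa [Nat.le_div_iff_mul_le hb]
  have e2 : q * p ^ a ≤ p ^ np / q ^ b := by rwa [Nat.le_div_iff_mul_le hb]
  have hM : 0 < p ^ np / q ^ b := lt_of_lt_of_le (by positivity) e1
  refine ⟨p ^ np / q ^ b, Nat.clog q (p ^ a * (p ^ np / q ^ b)), Nat.mul_div_le _ _, ?_,
    Nat.le_pow_clog hq _, ?_, e1, e2⟩
  · have h3 := Nat.lt_mul_div_succ (p ^ np) hb
    have h4 : q ^ b * (p ^ np / q ^ b + 1) ≤ 2 * (q ^ b * (p ^ np / q ^ b)) := by nlinarith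
    have h5 : 2 * (q ^ b * (p ^ np / q ^ b)) ≤ q * (q ^ b * (p ^ np / q ^ b)) :=
      Nat.mul_le_mul_right _ hq
    omega
  · set x := p ^ a * (p ^ np / q ^ b) with hx
    have hx1 : 1 < x := by
      have : 1 * 2 ≤ x := by
        apply Nat.mul_le_mul ha
        have : 2 * 1 ≤ p * q ^ b := Nat.mul_le_mul hp hb
        omega
      omega
    have h6 := Nat.pow_pred_clog_lt_self hq hx1
    have h7 : Nat.clog q x ≠ 0 := by
      have := Nat.clog_pos hq hx1
      omega
    have h8 : q ^ Nat.clog q x = q * q ^ (Nat.clog q x).pred := by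
      conv_lhs => rw [← Nat.succ_pred_eq_of_ne_zero h7]
      rw [pow_succ]; ring
    rw [h8]
    exact Nat.mul_lt_mul_of_pos_left h6 (by omega)

theorem core {p q a b np nq M A f C : ℕ} (hp : 1 < p) (hq : 1 < q) (hco : Nat.Coprime p q)
    (m1 : q ^ b * M ≤ p ^ np) (m2 : p ^ np ≤ q * (q ^ b * M)) (m3 : p ^ a * M ≤ q ^ nq)
    (m4 : q ^ nq < q * (p ^ a * M)) (m5 : p * q ^ b ≤ M) (m6 : q * p ^ a ≤ M)
    (hA : p ^ (a + np) ∣ A) (hC : q ^ f ≤ C * p ^ (a + np))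
    (hs : A % q ^ f + p ^ (a + np) ≤ q ^ f) :
    ∃ g mid : ℕ, p ^ a ∣ g ∧ q ^ b ∣ g ∧ mid ≤ C * q * q ∧
      ((digitSum p g : ℝ) - digitSum p A - np * sg p) ^ 2 ≤ 8 * vr p * q * np ∧
      ((digitSum q g : ℝ) - mid - digitSum q (A / q ^ f) - nq * sg q) ^ 2 ≤ 8 * vr q * q * nq := by
  have hpa : 0 < p ^ a := by positivity
  have hqb : 0 < q ^ b := by positivity
  have hpe : p ^ (a + np) = p ^ a * p ^ np := pow_add _ _ _
  -- bn ≤ f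
  have hbn : b + nq ≤ f := by
    have h1 : q ^ (b + nq) < q ^ (f + 1) := by
      calc q ^ (b + nq) = q ^ b * q ^ nq := pow_add _ _ _
        _ < q ^ b * (q * (p ^ a * M)) := Nat.mul_lt_mul_of_pos_left m4 hqb
        _ = q * (p ^ a * (q ^ b * M)) := by ring
        _ ≤ q * (p ^ a * p ^ np) := by gcongr
        _ ≤ q * q ^ f := by rw [← hpe]; exact Nat.mul_le_mul_left _ ((Nat.le_add_left _ _).trans hs)
        _ = _ := by ring
    have := (Nat.pow_lt_pow_iff_right hq).1 h1
    omega
  have hfb : f - (b + nq) ≤ C * q := by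
    have h1 : q ^ (b + nq) * q ^ (f - (b + nq)) ≤ q ^ (b + nq) * (C * q) := by
      rw [← pow_add, Nat.add_sub_cancel' hbn]
      calc q ^ f ≤ C * (p ^ a * p ^ np) := by rw [← hpe]; exact hC
        _ ≤ C * (p ^ a * (q * (q ^ b * M))) := by gcongr
        _ = C * q * q ^ b * (p ^ a * M) := by ring
        _ ≤ C * q * q ^ b * q ^ nq := by gcongr
        _ = _ := by rw [pow_add]; ring
    have h2 := Nat.le_of_mul_le_mul_left h1 (by positivity)
    exact (Nat.lt_pow_self hq).le.trans h2
  -- residue v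
  obtain ⟨v, hv, hvA⟩ : ∃ v < q ^ b, q ^ b ∣ A + p ^ a * v := by
    have hc : Nat.Coprime (p ^ a) (q ^ b) := Nat.Coprime.pow _ _ hco
    have : NeZero (q ^ b) := ⟨hqb.ne'⟩
    let u := ZMod.unitOfCoprime (p ^ a) hc
    refine ⟨((u⁻¹ : (ZMod (q ^ b))ˣ) * (-(A : ZMod (q ^ b))) : ZMod (q ^ b)).val, ZMod.val_lt _, ?_⟩
    rw [← ZMod.natCast_eq_zero_iff]
    rw [Nat.cast_add, Nat.cast_mul, ZMod.natCast_zmod_val]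
    have hu : ((p ^ a : ℕ) : ZMod (q ^ b)) = (u : ZMod (q ^ b)) := by
      simp [u, ZMod.coe_unitOfCoprime]
    rw [hu, Units.mul_inv_cancel_left]
    ring
  obtain ⟨w, hw⟩ := hvA
  have hF : (1:ℝ) ≤ q := by exact_mod_cast hq.le
  obtain ⟨m, hm, d1, d2⟩ := ap_pair (p := p) (q := q) (a := a) (b := b) (M := M) (np := np) (nq := nq)
    v w (F := (q:ℝ)) hp hq hco hF m1 (by exact_mod_cast m2) m3 (by exact_mod_cast m4.le) m5 m6
  have hx : v + q ^ b * m < p ^ np := by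
    have : q ^ b * (m + 1) ≤ q ^ b * M := Nat.mul_le_mul_left _ hm
    rw [mul_add] at this
    omega
  rw [Nat.mod_eq_of_lt hx] at d1
  have hg : A + p ^ a * (v + q ^ b * m) = q ^ b * (w + p ^ a * m) := by
    rw [mul_add (q ^ b), ← hw]; ring
  obtain ⟨A', hA'⟩ := hA
  have hgp : A + p ^ a * (v + q ^ b * m) = p ^ a * ((v + q ^ b * m) + p ^ np * A') := by
    rw [hA', hpe]; ring
  have hgf : (A + p ^ a * (v + q ^ b * m)) / q ^ f = A / q ^ f := by
    have h1 : p ^ a * (v + q ^ b * m) < p ^ (a + np) := by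
      rw [hpe]; exact Nat.mul_lt_mul_of_pos_left hx hpa
    have h2 := Nat.div_add_mod A (q ^ f)
    have h3 : A + p ^ a * (v + q ^ b * m)
        = (A % q ^ f + p ^ a * (v + q ^ b * m)) + q ^ f * (A / q ^ f) := by omega
    rw [h3, Nat.add_mul_div_left _ _ (by positivity), Nat.div_eq_of_lt (by omega), zero_add]
  set g := A + p ^ a * (v + q ^ b * m) with hgdef
  have sp : digitSum p g = digitSum p (v + q ^ b * m) + digitSum p A := by
    rw [hgp, ds_mul_pow hp, ds_add_mul hp np hx, hA', ds_mul_pow hp]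
  have sq : digitSum q g = digitSum q ((w + p ^ a * m) % q ^ nq) +
      (digitSum q ((w + p ^ a * m) / q ^ nq % q ^ (f - (b + nq))) + digitSum q (A / q ^ f)) := by
    rw [hg, ds_mul_pow hq, ds_split hq nq (w + p ^ a * m),
      ds_split hq (f - (b + nq)) ((w + p ^ a * m) / q ^ nq)]
    congr 3
    rw [← hgf, hg, Nat.div_div_eq_div_mul, ← pow_add]
    have : q ^ f = q ^ b * q ^ (nq + (f - (b + nq))) := by rw [← pow_add]; congr 1; omega
    rw [this, Nat.mul_div_mul_left _ _ hqb]
  refine ⟨g, digitSum q ((w + p ^ a * m) / q ^ nq % q ^ (f - (b + nq))), ⟨_, hgp⟩, ⟨_, hg⟩, ?_, ?_, ?_⟩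
  · refine (ds_le hq (f - (b + nq)) (Nat.mod_lt _ (by positivity))).trans ?_
    exact Nat.mul_le_mul hfb (by omega)
  · rw [sp]; push_cast
    convert d1 using 2; ring
  · rw [sq]; push_cast
    convert d2 using 2; ring


theorem nq_bound {p q a b np nq M : ℕ} (hp : 1 < p) (hq : 1 < q)
    (m1 : q ^ b * M ≤ p ^ np) (m4 : q ^ nq < q * (p ^ a * M)) :
    ((nq : ℝ) + b) * Real.log q ≤ Real.log q + (a + np) * Real.log p := by
  have h1 : q ^ (nq + b) ≤ q * p ^ (a + np) := by
    calc q ^ (nq + b) = q ^ b * q ^ nq := by rw [pow_add]; ring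
      _ ≤ q ^ b * (q * (p ^ a * M)) := Nat.mul_le_mul_left _ m4.le
      _ = q * (p ^ a * (q ^ b * M)) := by ring
      _ ≤ q * (p ^ a * p ^ np) := by gcongr
      _ = _ := by rw [pow_add]
  have hp0 : (0:ℝ) < p := by exact_mod_cast (by omega : 0 < p)
  have hq0 : (0:ℝ) < q := by exact_mod_cast (by omega : 0 < q)
  have h2 : ((q:ℝ)) ^ (nq + b) ≤ q * p ^ (a + np) := by exact_mod_cast h1
  have h3 := Real.log_le_log (by positivity) h2
  rw [Real.log_mul (by positivity) (by positivity), Real.log_pow, Real.log_pow] at h3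
  push_cast at h3
  exact h3

theorem abs_of_sq {x V n k t : ℝ} (h : x ^ 2 ≤ V * n) (hV : 0 ≤ V) (hn : n ≤ k * t)
    (ht : 0 ≤ t) (hc : 64 * (V * k) ≤ t) : |x| ≤ t / 8 := by
  apply abs_le_of_sq_le_sq _ (by positivity)
  calc x ^ 2 ≤ V * n := h
    _ ≤ V * (k * t) := by gcongr
    _ = V * k * t := by ring
    _ ≤ t / 64 * t := by gcongr; linarith
    _ = _ := by ring

theorem eps_aux {δ D : ℝ} (hδ : 0 < δ) (hD : 0 < D) (t : ℝ) :
    δ / (64 * D) * (8 * D * t / δ) = t / 8 := by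
  field_simp; norm_num

set_option maxHeartbeats 2000000 in
theorem half {p q : ℕ} (hp : 1 < p) (hq : 1 < q) (hco : Nat.Coprime p q) {δ cp cq : ℝ}
    (hδ : 0 < δ) (hcp : 0 ≤ cp) (hcq : 0 ≤ cq) :
    ∃ K₀ : ℕ, ∀ kp kq : ℕ, K₀ ≤ kp → δ * (kq : ℝ) ≤ kp →
      kp * Real.log p / sg p ≤ kq * Real.log q / sg q →
      ∃ i g : ℕ, p ^ (26 * (512 * 8 ^ i)) ∣ g ∧ q ^ (26 * (512 * 8 ^ i)) ∣ g ∧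
        |(kp : ℝ) - digitSum p g - cp * (512 * 8 ^ i : ℕ)| ≤ 3 / 2 * (512 * 8 ^ i : ℕ) ∧
        |(kq : ℝ) - digitSum q g - cq * (512 * 8 ^ i : ℕ)| ≤ 3 / 2 * (512 * 8 ^ i : ℕ) := by
  have hp0 : (2:ℝ) ≤ p := by exact_mod_cast hp
  have hq0 : (2:ℝ) ≤ q := by exact_mod_cast hq
  have hsp : 1 / 2 ≤ sg p := by unfold sg; linarith
  have hsq : 1 / 2 ≤ sg q := by unfold sg; linarith
  have hvp := vr_pos hp
  have hvq := vr_pos hq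
  obtain ⟨B, hB⟩ := exists_nat_ge (2 * cq + 52 * p + 26)
  have hB26 : 26 ≤ B := by
    have : (26:ℝ) ≤ B := by linarith
    exact_mod_cast this
  set W := 2 * q * B + 26 + q + 1 with hW
  obtain ⟨D, hD⟩ := exists_nat_ge ((W : ℝ) * sg p + cp + δ + 1)
  have hWs : (0:ℝ) ≤ W * sg p := by positivity
  have hD1 : (1:ℝ) ≤ D := by linarith
  have hDδ : δ ≤ D := by linarith
  have hD0 : 0 < D := by exact_mod_cast (by linarith : (0:ℝ) < D)
  obtain ⟨C, hC⟩ := sparse hp hq hco (ε := δ / (64 * D)) (by positivity)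
    (by rw [div_le_one (by positivity)]; linarith)
  obtain ⟨T0, hT0⟩ := exists_nat_ge (64 * ((8 * vr p * q) * (16 * D)) +
    64 * ((8 * vr q * q) * (16 * D / δ)) + C * q * q + C + sg p + 1)
  refine ⟨8 * D * T0 + 512 * D, ?_⟩
  intro kp kq hkp hkδ hlog
  -- choice of the scale
  obtain ⟨i, hi1, hi2⟩ : ∃ i : ℕ, D * (512 * 8 ^ i) ≤ kp ∧ kp < 8 * D * (512 * 8 ^ i) := by
    have hpos : 0 < 512 * D := by positivity
    have h0 : kp / (512 * D) ≠ 0 := by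
      rw [Nat.div_ne_zero_iff]; constructor <;> omega
    refine ⟨Nat.log 8 (kp / (512 * D)), ?_, ?_⟩
    · have := Nat.pow_log_le_self 8 h0
      rw [Nat.le_div_iff_mul_le hpos] at this
      linarith
    · have := Nat.lt_pow_succ_log_self (b := 8) (by norm_num) (kp / (512 * D))
      rw [Nat.div_lt_iff_lt_mul hpos, pow_succ] at this
      linarith
  refine ⟨i, ?_⟩
  set t := 512 * 8 ^ i with ht
  have ht1 : 1 ≤ t := by rw [ht]; have : 0 < 8 ^ i := by positivity
                         omega
  have ht1r : (1:ℝ) ≤ t := by exact_mod_cast ht1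
  have hi1r : (D:ℝ) * t ≤ kp := by exact_mod_cast hi1
  have hi2r : (kp:ℝ) ≤ 8 * D * t := by exact_mod_cast hi2.le
  have htT : T0 ≤ t := by
    have : 8 * D * T0 < 8 * D * t := by omega
    exact (Nat.lt_of_mul_lt_mul_left this).le
  have htTr : (T0:ℝ) ≤ t := by exact_mod_cast htT
  have b1 : 0 ≤ 64 * ((8 * vr p * q) * (16 * (D:ℝ))) := by positivity
  have b2 : 0 ≤ 64 * ((8 * vr q * q) * (16 * (D:ℝ) / δ)) := by positivity
  have b3 : (0:ℝ) ≤ C * q * q := by positivity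
  have b4 : (0:ℝ) ≤ C := by positivity
  -- np
  have hWt : (W:ℝ) * t * sg p + cp * t ≤ kp := by
    have : ((W:ℝ) * sg p + cp) * t ≤ D * t := by gcongr; linarith
    linarith
  set np := ⌊((kp:ℝ) - cp * t) / sg p⌋₊ with hnp
  have hsp0 : 0 < sg p := by linarith
  have hsq0 : 0 < sg q := by linarith
  have hn0 : 0 ≤ ((kp:ℝ) - cp * t) / sg p := by
    apply div_nonneg _ hsp0.le
    have : 0 ≤ (W:ℝ) * t * sg p := by positivity
    linarith
  have hnW : W * t ≤ np := by
    apply Nat.le_floor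
    rw [le_div_iff₀ hsp0]; push_cast; linarith
  have hn1 : np * sg p ≤ kp - cp * t := by
    have := Nat.floor_le hn0
    rwa [le_div_iff₀ hsp0] at this
  have hn2 : (kp:ℝ) - cp * t ≤ np * sg p + sg p := by
    have := (Nat.lt_floor_add_one (((kp:ℝ) - cp * t) / sg p)).le
    rw [div_le_iff₀ hsp0] at this
    linarith
  set a := 26 * t with ha
  set b := B * t with hb
  have hWexp : W * t = 2 * (q * b) + a + (q + 1) * t := by rw [hW, ha, hb]; ring
  have hqt : q + 1 ≤ (q + 1) * t := Nat.le_mul_of_pos_right _ ht1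
  have hqp : q ≤ p ^ q := (Nat.lt_pow_self hp).le
  have hqbp : q ^ b ≤ p ^ (q * b) := by rw [pow_mul p q b]; exact Nat.pow_le_pow_left hqp b
  obtain ⟨M, nq, m1, m2, m3, m4, m5, m6⟩ := params (p := p) (q := q) (a := a) (b := b) (np := np) hp hq
    (by
      calc p * q ^ b * q ^ b ≤ p * p ^ (q * b) * p ^ (q * b) := by gcongr
        _ = p ^ (1 + q * b + q * b) := by rw [pow_add, pow_add, pow_one]
        _ ≤ p ^ np := Nat.pow_le_pow_right (by omega) (by omega))
    (by
      calc q * p ^ a * q ^ b ≤ p ^ q * p ^ a * p ^ (q * b) := by gcongr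
        _ = p ^ (q + a + q * b) := by rw [pow_add, pow_add]
        _ ≤ p ^ np := Nat.pow_le_pow_right (by omega) (by omega))
  -- bound for nq
  have hlq : 1 / 2 ≤ Real.log q := by
    have h1 := Real.log_two_gt_d9
    have h2 := Real.log_le_log (by norm_num) hq0
    linarith
  have hlq0 : 0 < Real.log q := by linarith
  have hlp : Real.log p ≤ 2 * p * Real.log q := by
    have h1 := Real.log_le_sub_one_of_pos (show (0:ℝ) < p by linarith)
    have h2 : (p:ℝ) * (1 / 2) ≤ p * Real.log q := by gcongr
    linarith
  have hlp0 : 0 < Real.log p := Real.log_pos (by linarith)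
  have hnq : sg q * nq ≤ kq - cq * t := by
    have h1 := nq_bound hp hq m1 m4
    have h2 : np * Real.log p ≤ kq * Real.log q / sg q := by
      refine le_trans ?_ hlog
      rw [le_div_iff₀ hsp0]
      have h3 : np * sg p ≤ kp := by
        have : 0 ≤ cp * t := by positivity
        linarith
      calc np * Real.log p * sg p = np * sg p * Real.log p := by ring
        _ ≤ _ := by gcongr
    have h3 : (a:ℝ) * Real.log p ≤ 26 * t * (2 * p * Real.log q) := by
      rw [ha]; push_cast; gcongr
    have h4 : ((nq:ℝ) + b) * Real.log q ≤ (1 + 52 * p * t + kq / sg q) * Real.log q := by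
      have e1 : kq * Real.log q / sg q = kq / sg q * Real.log q := by ring
      rw [e1] at h2
      have e2 : ((a:ℝ) + np) * Real.log p = a * Real.log p + np * Real.log p := by ring
      have e3 : (1 + 52 * p * t + kq / sg q) * Real.log q =
        Real.log q + 26 * t * (2 * p * Real.log q) + kq / sg q * Real.log q := by ring
      rw [e3]; rw [e2] at h1; linarith
    have h5 := le_of_mul_le_mul_right h4 hlq0
    have h6 := mul_le_mul_of_nonneg_left h5 hsq0.le
    have e4 : sg q * (1 + 52 * p * t + kq / sg q) = sg q * (1 + 52 * p * t) + kq := by field_simp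
    rw [e4] at h6
    have h7 : 1 + 52 * p * t + 2 * (cq * t) ≤ (b:ℝ) := by
      have : (2 * cq + 52 * p + 26) * t ≤ (B:ℝ) * t := by gcongr
      rw [hb]; push_cast; linarith
    have h8 := mul_le_mul_of_nonneg_left h7 hsq0.le
    have h9 : cq * t ≤ sg q * (2 * (cq * t)) := by
      have : 0 ≤ cq * t := by positivity
      have : 1 / 2 * (2 * (cq * t)) ≤ sg q * (2 * (cq * t)) := by gcongr
      linarith
    rw [mul_add] at h6 h8
    linarith
  set Y := ⌊(kq:ℝ) - cq * t - sg q * nq⌋₊ with hY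
  have hY1 : (Y:ℝ) ≤ kq - cq * t - sg q * nq := Nat.floor_le (by linarith)
  have hY2 : (kq:ℝ) - cq * t - sg q * nq ≤ Y + 1 := (Nat.lt_floor_add_one _).le
  have hcqt : 0 ≤ cq * t := by positivity
  have hcpt : 0 ≤ cp * t := by positivity
  have hsn : 0 ≤ sg q * nq := by positivity
  have hkq : (kq:ℝ) ≤ 8 * D * t / δ := by
    rw [le_div_iff₀ hδ]; linarith
  have hεY : δ / (64 * D) * Y ≤ t / 8 := by
    calc δ / (64 * D) * Y ≤ δ / (64 * D) * (8 * D * t / δ) := by gcongr; linarith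
      _ = t / 8 := eps_aux hδ (by linarith) _
  obtain ⟨A, f, hA, sA, hf, sY, hs⟩ := hC (a + np) Y
  obtain ⟨g, mid, g1, g2, hmid, d1, d2⟩ := core hp hq hco m1 m2 m3 m4 m5 m6 hA hf hs
  have hmidr : (mid:ℝ) ≤ C * q * q := by exact_mod_cast hmid
  have hmid0 : (0:ℝ) ≤ mid := by positivity
  have hsA0 : (0:ℝ) ≤ digitSum p A := by positivity
  have hnp2 : (np:ℝ) ≤ 16 * D * t := by
    have : (np:ℝ) * (1 / 2) ≤ np * sg p := by gcongr
    linarith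
  have hnq2 : (nq:ℝ) ≤ 16 * D / δ * t := by
    have h1 : 1 / 2 * (nq:ℝ) ≤ sg q * nq := by gcongr
    have h2 : 16 * D / δ * t = 2 * (8 * D * t / δ) := by ring
    rw [h2]; linarith
  have D1 := abs_of_sq d1 (by positivity) hnp2 (by linarith) (by linarith)
  have D2 := abs_of_sq d2 (by positivity) hnq2 (by linarith) (by linarith)
  refine ⟨g, g1, (pow_dvd_pow q (Nat.mul_le_mul_right _ hB26)).trans g2, ?_, ?_⟩
  · rw [abs_le] at D1 ⊢
    constructor <;> linarith
  · rw [abs_le] at D2 sY ⊢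
    constructor <;> linarith

theorem stmt1 :
    ∀ δ > (0:ℝ), ∃ K₀ : ℕ, 0 < K₀ ∧
      ∀ k₁ k₂ : ℕ, K₀ ≤ k₁ → K₀ ≤ k₂ →
        δ * (k₂ : ℝ) ≤ (k₁ : ℝ) → δ * (k₁ : ℝ) ≤ (k₂ : ℝ) →
        ∃ n : ℕ, digitSum 2 n = k₁ ∧ digitSum 3 n = k₂ := by
  intro δ hδ
  obtain ⟨K1, h1⟩ := half (p := 2) (q := 3) (by norm_num) (by norm_num) (by norm_num) hδ
    (cp := 19 / 2) (cq := 12) (by norm_num) (by norm_num)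
  obtain ⟨K2, h2⟩ := half (p := 3) (q := 2) (by norm_num) (by norm_num) (by norm_num) hδ
    (cp := 12) (cq := 19 / 2) (by norm_num) (by norm_num)
  refine ⟨K1 + K2 + 1, by omega, ?_⟩
  intro k₁ k₂ hk1 hk2 hd1 hd2
  have key : ∃ i g : ℕ, 2 ^ (26 * (512 * 8 ^ i)) ∣ g ∧ 3 ^ (26 * (512 * 8 ^ i)) ∣ g ∧
        |(k₁ : ℝ) - digitSum 2 g - 19 / 2 * (512 * 8 ^ i : ℕ)| ≤ 3 / 2 * (512 * 8 ^ i : ℕ) ∧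
        |(k₂ : ℝ) - digitSum 3 g - 12 * (512 * 8 ^ i : ℕ)| ≤ 3 / 2 * (512 * 8 ^ i : ℕ) := by
    rcases le_total (k₁ * Real.log (2:ℕ) / sg 2) (k₂ * Real.log (3:ℕ) / sg 3) with h | h
    · exact h1 k₁ k₂ (by omega) hd1 h
    · obtain ⟨i, g, a1, a2, a3, a4⟩ := h2 k₂ k₁ (by omega) hd2 h
      exact ⟨i, g, a2, a1, a4, a3⟩
  obtain ⟨i, g, g2, g3, e1, e2⟩ := key
  have hbox := box_all i
  set t := 512 * 8 ^ i with ht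
  have ht0 : (0:ℝ) ≤ t := by positivity
  rw [abs_le] at e1 e2
  have l1 : digitSum 2 g ≤ k₁ := by
    have : (digitSum 2 g : ℝ) ≤ k₁ := by linarith
    exact_mod_cast this
  have l2 : digitSum 3 g ≤ k₂ := by
    have : (digitSum 3 g : ℝ) ≤ k₂ := by linarith
    exact_mod_cast this
  obtain ⟨i1, rfl⟩ := Nat.exists_eq_add_of_le l1
  obtain ⟨i2, rfl⟩ := Nat.exists_eq_add_of_le l2
  push_cast at e1 e2
  have c1 : 95 * t ≤ 12 * i1 := by
    have : (95:ℝ) * t ≤ 12 * i1 := by linarith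
    exact_mod_cast this
  have c2 : 12 * i1 ≤ 133 * t := by
    have : 12 * (i1:ℝ) ≤ 133 * t := by linarith
    exact_mod_cast this
  have c3 : 10 * t ≤ i2 := by
    have : (10:ℝ) * t ≤ i2 := by linarith
    exact_mod_cast this
  have c4 : i2 ≤ 14 * t := by
    have : (i2:ℝ) ≤ 14 * t := by linarith
    exact_mod_cast this
  obtain ⟨r, hr, r2, r3⟩ := hbox i1 i2 c1 c2 c3 c4
  have := gadget_add (R := 2 ^ (26 * t)) (a := 26 * t) (b := 26 * t) (g := g) (r := r) le_rfl
    (Nat.pow_le_pow_left (by norm_num) _) hr g2 g3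
  exact ⟨g + r, by rw [this.1, r2], by rw [this.2, r3]⟩
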